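/- Let u be a solution of the mean field equation Δu = λ(1−e^u) on S² with λ = 6. If e^{u(x)} ≤ 2 for all x ∈ S², then u ≡ 0. -/

import Mathlib

open Real MeasureTheory

noncomputable section

/-- Euclidean Laplacian on ℝ² via the second iterated derivative. -/
def lap (w : ℝ × ℝ → ℝ) (y : ℝ × ℝ) : ℝ :=
  iteratedFDeriv ℝ 2 w y ![(1, 0), (1, 0)] + iteratedFDeriv ℝ 2 w y ![(0, 1), (0, 1)]

/-- The unit sphere S² ⊂ ℝ³ (vectors encoded as functions `Fin 3 → ℝ`). -/
def sphere3 : Set (Fin 3 → ℝ) := {x | x 0 ^ 2 + x 1 ^ 2 + x 2 ^ 2 = 1}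

/-- Inverse stereographic projection from the north pole. -/
def stereoN (y : ℝ × ℝ) : Fin 3 → ℝ :=
  ![2 * y.1 / (1 + y.1 ^ 2 + y.2 ^ 2), 2 * y.2 / (1 + y.1 ^ 2 + y.2 ^ 2),
    (y.1 ^ 2 + y.2 ^ 2 - 1) / (1 + y.1 ^ 2 + y.2 ^ 2)]

/-- South-pole parametrization of the sphere. -/
def stereoS (y : ℝ × ℝ) : Fin 3 → ℝ :=
  ![2 * y.1 / (1 + y.1 ^ 2 + y.2 ^ 2), 2 * y.2 / (1 + y.1 ^ 2 + y.2 ^ 2),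
    (1 - y.1 ^ 2 - y.2 ^ 2) / (1 + y.1 ^ 2 + y.2 ^ 2)]

/-- `u` is a solution of the mean field equation `Δu = lam (1 - e^u)` on `S²`,
expressed in the two stereographic charts. -/
def IsMFSolution (lam : ℝ) (u : (Fin 3 → ℝ) → ℝ) : Prop :=
  ContinuousOn u sphere3 ∧
  ContDiff ℝ 2 (fun y => u (stereoN y)) ∧
  ContDiff ℝ 2 (fun y => u (stereoS y)) ∧
  (∀ y : ℝ × ℝ, lap (fun z => u (stereoN z)) y =
    4 * lam * (1 - Real.exp (u (stereoN y))) / (1 + y.1 ^ 2 + y.2 ^ 2) ^ 2) ∧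
  (∀ y : ℝ × ℝ, lap (fun z => u (stereoS z)) y =
    4 * lam * (1 - Real.exp (u (stereoS y))) / (1 + y.1 ^ 2 + y.2 ^ 2) ^ 2)

/-- `u` is axially symmetric on `S²`: constant on the level sets of `⟨·, e⟩`
for some unit vector `e`. -/
def AxiallySymmetric (u : (Fin 3 → ℝ) → ℝ) : Prop :=
  ∃ e : Fin 3 → ℝ, e 0 ^ 2 + e 1 ^ 2 + e 2 ^ 2 = 1 ∧
    ∀ x ∈ sphere3, ∀ x' ∈ sphere3,
      x 0 * e 0 + x 1 * e 1 + x 2 * e 2 = x' 0 * e 0 + x' 1 * e 1 + x' 2 * e 2 →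
      u x = u x'

/-- Surface integral over `S²`, written in the north-pole stereographic chart. -/
def sphereIntegral (f : (Fin 3 → ℝ) → ℝ) : ℝ :=
  ∫ y : ℝ × ℝ, f (stereoN y) * (4 / (1 + y.1 ^ 2 + y.2 ^ 2) ^ 2)

namespace MF

abbrev V := Fin 3 → ℝ

def Om : Set V := {x | x ≠ 0}

def nsq (x : V) : ℝ := x 0 ^ 2 + x 1 ^ 2 + x 2 ^ 2

def rr (x : V) : ℝ := Real.sqrt (nsq x)

def xi (i : Fin 3) (x : V) : ℝ := x i / rr x

def rot (i : Fin 3) (x : V) : V :=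
  ![![0, - x 2, x 1], ![x 2, 0, - x 0], ![- x 1, x 0, 0]] i

def X (i : Fin 3) (f : V → ℝ) (x : V) : ℝ := fderiv ℝ f x (rot i x)

def bmp : ContDiffBump (2 : ℝ) := ⟨1/2, 1, by norm_num, by norm_num⟩

def cut (x : V) : ℝ := bmp (nsq x)

def rho (x : V) : ℝ := cut x ^ 2

def Z0 : ℝ := ∫ x : V, rho x

def I (f : V → ℝ) : ℝ := (∫ x : V, f x * rho x) / Z0

lemma isOpen_Om : IsOpen Om := isOpen_ne

lemma nsq_pos {x : V} (hx : x ∈ Om) : 0 < nsq x := by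
  have h0 : 0 ≤ nsq x := by unfold nsq; positivity
  rcases h0.lt_or_eq with h | h
  · exact h
  · exfalso
    apply hx
    unfold nsq at h
    funext i
    fin_cases i <;> simp <;> nlinarith [sq_nonneg (x 0), sq_nonneg (x 1), sq_nonneg (x 2)]

lemma contDiff_nsq {n : WithTop ℕ∞} : ContDiff ℝ n nsq := by
  unfold nsq; fun_prop

lemma continuous_nsq : Continuous nsq := by
  unfold nsq; fun_prop

lemma contDiff_cut {n : ℕ∞} : ContDiff ℝ n cut := by
  unfold cut; exact bmp.contDiff.comp contDiff_nsq

lemma contDiff_rho {n : ℕ∞} : ContDiff ℝ n rho := by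
  unfold rho; exact contDiff_cut.pow 2

lemma cut_zero {x : V} (hx : nsq x ≤ 1) : cut x = 0 := by
  unfold cut
  apply bmp.zero_of_le_dist
  rw [Real.dist_eq, abs_of_nonpos (by linarith)]
  show (1:ℝ) ≤ _
  linarith

lemma cut_zero' {x : V} (hx : 3 ≤ nsq x) : cut x = 0 := by
  unfold cut
  apply bmp.zero_of_le_dist
  rw [Real.dist_eq, abs_of_nonneg (by linarith)]
  show (1:ℝ) ≤ _
  linarith

lemma cut_one {x : V} (hx : nsq x = 2) : cut x = 1 := by
  unfold cut
  apply bmp.one_of_mem_closedBall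
  rw [hx]
  exact Metric.mem_closedBall_self (by show (0:ℝ) ≤ 1/2; norm_num)

lemma zero_nsq : nsq 0 = 0 := by simp [nsq]

lemma cut_ev_zero : ∀ᶠ x in nhds (0:V), cut x = 0 := by
  have : {x : V | nsq x < 1} ∈ nhds (0:V) :=
    (isOpen_lt continuous_nsq continuous_const).mem_nhds (by simp [zero_nsq])
  filter_upwards [this] with x hx using cut_zero (le_of_lt hx)

lemma rho_zero : rho 0 = 0 := by unfold rho; rw [cut_zero (by rw [zero_nsq]; norm_num)]; norm_num

lemma hcs_cut : HasCompactSupport cut := by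
  apply HasCompactSupport.of_support_subset_isCompact (isCompact_closedBall (0:V) 2)
  intro x hx
  rw [mem_closedBall_zero_iff, pi_norm_le_iff_of_nonneg (by norm_num)]
  have h3 : nsq x < 3 := by
    by_contra h
    exact hx (cut_zero' (not_lt.mp h))
  unfold nsq at h3
  intro i
  rw [Real.norm_eq_abs, abs_le]
  fin_cases i <;> simp <;>
    constructor <;> nlinarith [sq_nonneg (x 0), sq_nonneg (x 1), sq_nonneg (x 2)]

lemma hcs_mul_cut (f : V → ℝ) : HasCompactSupport (fun x => f x * cut x) := hcs_cut.mul_left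

lemma hcs_mul (f : V → ℝ) : HasCompactSupport (fun x => f x * rho x) := by
  have : (fun x => f x * rho x) = (fun x => (f x * cut x) * cut x) := by
    funext x; unfold rho; ring
  rw [this]
  exact hcs_mul_cut _

lemma contDiff_mul_cut {n : ℕ∞} {f : V → ℝ} (hf : ContDiffOn ℝ n f Om) :
    ContDiff ℝ n (fun x => f x * cut x) := by
  rw [contDiff_iff_contDiffAt]
  intro x
  by_cases hx : x ∈ Om
  · exact (hf.contDiffAt (isOpen_Om.mem_nhds hx)).mul contDiff_cut.contDiffAt
  · have hx0 : x = 0 := by simpa [Om] using hx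
    subst hx0
    apply (contDiffAt_const (c := (0:ℝ))).congr_of_eventuallyEq
    filter_upwards [cut_ev_zero] with y hy
    rw [hy, mul_zero]

lemma continuous_mul_cut {f : V → ℝ} (hf : ContinuousOn f Om) :
    Continuous (fun x => f x * cut x) := by
  have := contDiff_mul_cut (n := 0) (f := f) (by exact_mod_cast contDiffOn_zero.mpr hf)
  exact this.continuous

lemma contDiff_mul_rho {n : ℕ∞} {f : V → ℝ} (hf : ContDiffOn ℝ n f Om) :
    ContDiff ℝ n (fun x => f x * rho x) := by
  have : (fun x => f x * rho x) = (fun x => (f x * cut x) * cut x) := by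
    funext x; unfold rho; ring
  rw [this]
  exact (contDiff_mul_cut hf).mul contDiff_cut

lemma continuous_mul_rho {f : V → ℝ} (hf : ContinuousOn f Om) :
    Continuous (fun x => f x * rho x) := by
  have : (fun x => f x * rho x) = (fun x => (f x * cut x) * cut x) := by
    funext x; unfold rho; ring
  rw [this]
  exact (continuous_mul_cut hf).mul (contDiff_cut (n := 0)).continuous

lemma integrable_mul_rho {f : V → ℝ} (hf : ContinuousOn f Om) :
    Integrable (fun x => f x * rho x) :=
  (continuous_mul_rho hf).integrable_of_hasCompactSupport (hcs_mul f)

lemma rho_nonneg (x : V) : 0 ≤ rho x := sq_nonneg _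

/-- point with `nsq = 2` on the ray through `x` -/
lemma exists_scale {x : V} (hx : x ∈ Om) : ∃ c : ℝ, 0 < c ∧ nsq (c • x) = 2 := by
  refine ⟨Real.sqrt (2 / nsq x), Real.sqrt_pos.mpr (div_pos two_pos (nsq_pos hx)), ?_⟩
  have : nsq (Real.sqrt (2 / nsq x) • x) = (Real.sqrt (2 / nsq x))^2 * nsq x := by
    simp [nsq]; ring
  rw [this, Real.sq_sqrt (div_pos two_pos (nsq_pos hx)).le]
  have := (nsq_pos hx).ne'
  field_simp

lemma Z0_pos : 0 < Z0 := by
  unfold Z0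
  obtain ⟨c, hc, h2⟩ := exists_scale (x := fun _ => 1) (by
    intro h; have := congrFun h 0; simp at this)
  have h1 : HasCompactSupport rho := by simpa using hcs_mul (fun _ => 1)
  refine (contDiff_rho (n := 0)).continuous.integral_pos_of_hasCompactSupport_nonneg_nonzero
    h1 rho_nonneg (x := c • fun _ => 1) ?_
  unfold rho; rw [cut_one h2]; norm_num

lemma I_one : I (fun _ => 1) = 1 := by
  unfold I
  simp only [one_mul]
  exact div_self Z0_pos.ne'

lemma I_congr {f g : V → ℝ} (h : ∀ x ∈ Om, f x = g x) : I f = I g := by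
  unfold I
  congr 1
  apply integral_congr_ae
  refine Filter.Eventually.of_forall fun x => ?_
  by_cases hx : x ∈ Om
  · simp only [h x hx]
  · have hx0 : x = 0 := by simpa [Om] using hx
    subst hx0
    simp [rho_zero]

lemma I_add {f g : V → ℝ} (hf : ContinuousOn f Om) (hg : ContinuousOn g Om) :
    I (fun x => f x + g x) = I f + I g := by
  unfold I
  rw [← add_div, ← integral_add (integrable_mul_rho hf) (integrable_mul_rho hg)]
  simp only [add_mul]

lemma I_smul (c : ℝ) (f : V → ℝ) : I (fun x => c * f x) = c * I f := by
  unfold I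
  rw [← mul_div_assoc, ← integral_const_mul]
  simp only [mul_assoc]

lemma I_zero : I (fun _ => 0) = 0 := by unfold I; simp

lemma I_nonneg {f : V → ℝ} (h : ∀ x ∈ Om, 0 ≤ f x) : 0 ≤ I f := by
  unfold I
  apply div_nonneg _ Z0_pos.le
  apply integral_nonneg
  intro x
  by_cases hx : x ∈ Om
  · exact mul_nonneg (h x hx) (rho_nonneg x)
  · have hx0 : x = 0 := by simpa [Om] using hx
    subst hx0
    simp [rho_zero]

lemma I_lin1 (a : ℝ) {F f : V → ℝ} (h : ∀ x ∈ Om, F x = a * f x) : I F = a * I f := by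
  rw [I_congr h, I_smul]

lemma I_lin2 (a b : ℝ) {F f g : V → ℝ} (hf : ContinuousOn f Om) (hg : ContinuousOn g Om)
    (h : ∀ x ∈ Om, F x = a * f x + b * g x) : I F = a * I f + b * I g := by
  rw [I_congr h, I_add (hf.const_mul a |> fun h => by simpa using h) (by fun_prop), I_smul, I_smul]

lemma I_lin3 (a b c : ℝ) {F f g k : V → ℝ} (hf : ContinuousOn f Om) (hg : ContinuousOn g Om)
    (hk : ContinuousOn k Om)
    (h : ∀ x ∈ Om, F x = a * f x + b * g x + c * k x) : I F = a * I f + b * I g + c * I k := by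
  rw [I_congr h, I_add (by fun_prop) (by fun_prop), I_add (by fun_prop) (by fun_prop),
    I_smul, I_smul, I_smul]

lemma I_lin4 (a b c d : ℝ) {F f g k l : V → ℝ} (hf : ContinuousOn f Om) (hg : ContinuousOn g Om)
    (hk : ContinuousOn k Om) (hl : ContinuousOn l Om)
    (h : ∀ x ∈ Om, F x = a * f x + b * g x + c * k x + d * l x) :
    I F = a * I f + b * I g + c * I k + d * I l := by
  rw [I_congr h, I_add (by fun_prop) (by fun_prop), I_add (by fun_prop) (by fun_prop),
    I_add (by fun_prop) (by fun_prop), I_smul, I_smul, I_smul, I_smul]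

lemma I_mono {f g : V → ℝ} (hf : ContinuousOn f Om) (hg : ContinuousOn g Om)
    (h : ∀ x ∈ Om, f x ≤ g x) : I f ≤ I g := by
  have h1 : 0 ≤ I (fun x => g x - f x) := I_nonneg fun x hx => sub_nonneg.mpr (h x hx)
  rw [I_lin2 1 (-1) hg hf (fun x _ => by ring)] at h1
  linarith

def Hom (f : V → ℝ) : Prop := ∀ c : ℝ, 0 < c → ∀ x ∈ Om, f (c • x) = f x

lemma smul_Om {c : ℝ} (hc : 0 < c) {x : V} (hx : x ∈ Om) : c • x ∈ Om := smul_ne_zero hc.ne' hx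

lemma I_pos_zero {F : V → ℝ} (hF : ContinuousOn F Om) (h0 : ∀ x ∈ Om, 0 ≤ F x) (hh : Hom F)
    (hI : I F ≤ 0) : ∀ x ∈ Om, F x = 0 := by
  intro x hx
  obtain ⟨c, hc, h2⟩ := exists_scale hx
  by_contra hne
  have : 0 < ∫ x : V, F x * rho x := by
    refine (continuous_mul_rho hF).integral_pos_of_hasCompactSupport_nonneg_nonzero
      (hcs_mul F) ?_ (x := c • x) ?_
    · intro x
      by_cases hx : x ∈ Om
      · exact mul_nonneg (h0 x hx) (rho_nonneg x)
      · have hx0 : x = 0 := by simpa [Om] using hx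
        subst hx0
        simp [rho_zero]
    · unfold rho
      rw [cut_one h2, hh c hc x hx]
      simpa using hne
  unfold I at hI
  have := div_pos this Z0_pos
  linarith

lemma nsq_neg (x : V) : nsq (-x) = nsq x := by simp [nsq]

lemma I_neg (f : V → ℝ) : I (fun x => f (-x)) = I f := by
  unfold I
  congr 1
  rw [← integral_neg_eq_self]
  congr 1
  funext x
  simp [rho, cut, nsq_neg]

lemma rot_zero (i : Fin 3) : rot i 0 = 0 := by
  funext j
  fin_cases i <;> fin_cases j <;> simp [rot]

lemma X_at_zero (i : Fin 3) (f : V → ℝ) : X i f 0 = 0 := by simp [X, rot_zero]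

lemma X_nsq (i : Fin 3) (x : V) : X i nsq x = 0 := by
  have h : HasFDerivAt nsq ((2 * x 0) • (ContinuousLinearMap.proj 0 : V →L[ℝ] ℝ)
      + (2 * x 1) • (ContinuousLinearMap.proj 1 : V →L[ℝ] ℝ)
      + (2 * x 2) • (ContinuousLinearMap.proj 2 : V →L[ℝ] ℝ)) x := by
    have h (i : Fin 3) : HasFDerivAt (fun x : V => x i ^ 2)
        ((2 * x i) • (ContinuousLinearMap.proj i : V →L[ℝ] ℝ)) x := by
      simpa using (hasFDerivAt_apply (𝕜 := ℝ) i x).pow 2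
    exact ((h 0).add (h 1)).add (h 2)
  unfold X
  rw [h.fderiv]
  fin_cases i <;> simp [rot] <;> ring

/-- chain rule -/
lemma X_comp (i : Fin 3) {f : V → ℝ} {x : V} {φ : ℝ → ℝ} {φ' : ℝ} (hf : DifferentiableAt ℝ f x)
    (hφ : HasDerivAt φ φ' (f x)) : X i (fun y => φ (f y)) x = φ' * X i f x := by
  unfold X
  have := hφ.comp_hasFDerivAt x hf.hasFDerivAt
  have h2 : fderiv ℝ (fun y => φ (f y)) x = φ' • fderiv ℝ f x := this.fderiv
  rw [h2]
  simp

lemma X_cut (i : Fin 3) (x : V) : X i cut x = 0 := by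
  have h := X_comp i (x := x) (f := nsq) (φ := bmp)
    (contDiff_nsq (n := 1) |>.differentiable (by norm_num) x)
    ((bmp.contDiff (n := 1)).differentiable (by norm_num) (nsq x)).hasDerivAt
  rw [X_nsq, mul_zero] at h
  exact h

lemma X_add (i : Fin 3) {f g : V → ℝ} {x : V} (hf : DifferentiableAt ℝ f x)
    (hg : DifferentiableAt ℝ g x) : X i (fun y => f y + g y) x = X i f x + X i g x := by
  unfold X
  rw [fderiv_fun_add hf hg]
  rfl

lemma X_mul (i : Fin 3) {f g : V → ℝ} {x : V} (hf : DifferentiableAt ℝ f x)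
    (hg : DifferentiableAt ℝ g x) :
    X i (fun y => f y * g y) x = f x * X i g x + X i f x * g x := by
  unfold X
  rw [fderiv_fun_mul hf hg]
  simp; ring

lemma X_const (i : Fin 3) (c : ℝ) (x : V) : X i (fun _ => c) x = 0 := by
  unfold X
  simp

lemma X_smul (i : Fin 3) (c : ℝ) {f : V → ℝ} {x : V} (hf : DifferentiableAt ℝ f x) :
    X i (fun y => c * f y) x = c * X i f x := by
  rw [X_mul i (differentiableAt_const c) hf, X_const]; ring

lemma X_congr (i : Fin 3) {f g : V → ℝ} (h : ∀ x ∈ Om, f x = g x) {x : V} (hx : x ∈ Om) :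
    X i f x = X i g x := by
  unfold X
  rw [Filter.EventuallyEq.fderiv_eq]
  filter_upwards [isOpen_Om.mem_nhds hx] with y hy using h y hy

lemma int_coord {G : V → ℝ} (hG : ContDiff ℝ 1 G) (hc : HasCompactSupport G) (a b : Fin 3)
    (hab : a ≠ b) : ∫ x : V, x a * fderiv ℝ G x (Pi.single b 1) = 0 := by
  have hfd : Continuous (fun x => fderiv ℝ G x (Pi.single b 1)) :=
    (hG.continuous_fderiv (by norm_num)).clm_apply continuous_const
  have hfdc : HasCompactSupport (fun x => fderiv ℝ G x (Pi.single b 1)) :=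
    hc.fderiv_apply (𝕜 := ℝ) (Pi.single b 1)
  have hd : ∀ x : V, fderiv ℝ (fun x : V => x a) x (Pi.single b 1) = 0 := by
    intro x
    rw [(hasFDerivAt_apply (𝕜 := ℝ) a x).fderiv]
    simp [hab]
  rw [integral_mul_fderiv_eq_neg_fderiv_mul_of_integrable]
  · simp [hd]
  · simp [hd]
  · exact ((continuous_apply a).mul hfd).integrable_of_hasCompactSupport hfdc.mul_left
  · exact ((continuous_apply a).mul hG.continuous).integrable_of_hasCompactSupport hc.mul_left
  · intro x _; fun_prop
  · intro x _; exact hG.differentiable (by norm_num) x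

lemma int_X {G : V → ℝ} (hG : ContDiff ℝ 1 G) (hc : HasCompactSupport G) (i : Fin 3) :
    ∫ x : V, X i G x = 0 := by
  have hInteg (a b : Fin 3) : Integrable (fun x : V => x a * fderiv ℝ G x (Pi.single b 1)) := by
    have hfd : Continuous (fun x => fderiv ℝ G x (Pi.single b 1)) :=
      (hG.continuous_fderiv (by norm_num)).clm_apply continuous_const
    have hfdc : HasCompactSupport (fun x => fderiv ℝ G x (Pi.single b 1)) :=
      hc.fderiv_apply (𝕜 := ℝ) (Pi.single b 1)
    exact ((continuous_apply a).mul hfd).integrable_of_hasCompactSupport hfdc.mul_left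
  have key (a b : Fin 3) (hab : a ≠ b) (hr : ∀ x : V, rot i x = x a • Pi.single b 1 - x b • Pi.single a 1) :
      ∫ x : V, X i G x = 0 := by
    have : (fun x => X i G x) = fun x => x a * fderiv ℝ G x (Pi.single b 1)
        - x b * fderiv ℝ G x (Pi.single a 1) := by
      funext x
      unfold X
      rw [hr]
      simp
    rw [this, integral_sub (hInteg a b) (hInteg b a), int_coord hG hc a b hab,
      int_coord hG hc b a hab.symm, sub_zero]
  fin_cases i
  · refine key 1 2 (by decide) fun x => ?_
    funext j; fin_cases j <;> simp [rot]
  · refine key 2 0 (by decide) fun x => ?_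
    funext j; fin_cases j <;> simp [rot]
  · refine key 0 1 (by decide) fun x => ?_
    funext j; fin_cases j <;> simp [rot]

lemma diffAt {n : WithTop ℕ∞} (hn : n ≠ 0) {f : V → ℝ} (hf : ContDiffOn ℝ n f Om) {x : V} (hx : x ∈ Om) :
    DifferentiableAt ℝ f x :=
  (hf.contDiffAt (isOpen_Om.mem_nhds hx)).differentiableAt hn

lemma I_X {f : V → ℝ} (hf : ContDiffOn ℝ 1 f Om) (i : Fin 3) : I (X i f) = 0 := by
  have h := int_X (contDiff_mul_rho (n := 1) (f := f) (by exact_mod_cast hf)) (hcs_mul f) i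
  unfold I
  have h2 : (fun x => X i f x * rho x) = fun x => X i (fun x => f x * rho x) x := by
    funext x
    by_cases hx : x ∈ Om
    · have hc : DifferentiableAt ℝ cut x := (contDiff_cut (n := 1)).differentiable (by norm_num) x
      have hr : X i rho x = 0 := by
        have : rho = fun x => cut x * cut x := by funext x; unfold rho; ring
        rw [this, X_mul i hc hc, X_cut]; ring
      rw [X_mul i (diffAt one_ne_zero hf hx)
        ((contDiff_rho (n := 1)).differentiable (by norm_num) x), hr]
      ring
    · have hx0 : x = 0 := by simpa [Om] using hx
      subst hx0
      rw [X_at_zero, X_at_zero, zero_mul]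
  rw [h2, h, zero_div]

end MF

namespace MF

def Grad (f g : V → ℝ) (x : V) : ℝ := X 0 f x * X 0 g x + X 1 f x * X 1 g x + X 2 f x * X 2 g x

def Lap (f : V → ℝ) (x : V) : ℝ := X 0 (X 0 f) x + X 1 (X 1 f) x + X 2 (X 2 f) x

lemma contDiff_rot (i : Fin 3) {n : WithTop ℕ∞} : ContDiff ℝ n (rot i) := by
  rw [contDiff_pi]
  intro j
  fin_cases i <;> fin_cases j <;> simp [rot] <;> fun_prop

lemma cdX (i : Fin 3) {n m : WithTop ℕ∞} (hnm : m + 1 ≤ n) {f : V → ℝ} {x : V}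
    (hf : ContDiffAt ℝ n f x) : ContDiffAt ℝ m (X i f) x :=
  (hf.fderiv_right hnm).clm_apply (contDiff_rot i).contDiffAt

lemma cdX1 (i : Fin 3) {f : V → ℝ} {x : V}
    (hf : ContDiffAt ℝ 2 f x) : ContDiffAt ℝ 1 (X i f) x := cdX i (by norm_num) hf

lemma daX (i : Fin 3) {f : V → ℝ} {x : V}
    (hf : ContDiffAt ℝ 2 f x) : DifferentiableAt ℝ (X i f) x :=
  (cdX1 i hf).differentiableAt (by norm_num)

lemma da {f : V → ℝ} {x : V} (hf : ContDiffAt ℝ 2 f x) : DifferentiableAt ℝ f x :=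
  hf.differentiableAt (by norm_num)

lemma evda {f : V → ℝ} {x : V} (hf : ContDiffAt ℝ 2 f x) :
    ∀ᶠ y in nhds x, DifferentiableAt ℝ f y := by
  filter_upwards [hf.eventually (by simp)] with y hy using da hy

lemma cdat {n : WithTop ℕ∞} {f : V → ℝ} (hf : ContDiffOn ℝ n f Om) {x : V} (hx : x ∈ Om) :
    ContDiffAt ℝ n f x := hf.contDiffAt (isOpen_Om.mem_nhds hx)

lemma cdonX (i : Fin 3) {n m : WithTop ℕ∞} (hnm : m + 1 ≤ n) {f : V → ℝ}
    (hf : ContDiffOn ℝ n f Om) : ContDiffOn ℝ m (X i f) Om :=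
  fun _ hx => (cdX i hnm (cdat hf hx)).contDiffWithinAt

lemma c2X (i : Fin 3) {f : V → ℝ}
    (hf : ContDiffOn ℝ 2 f Om) : ContDiffOn ℝ 1 (X i f) Om := cdonX i (by norm_num) hf

lemma c1X (i : Fin 3) {f : V → ℝ}
    (hf : ContDiffOn ℝ 1 f Om) : ContinuousOn (X i f) Om :=
  (cdonX i (m := 0) (by norm_num) hf).continuousOn

lemma c2c1 {f : V → ℝ} (hf : ContDiffOn ℝ 2 f Om) : ContDiffOn ℝ 1 f Om := hf.of_le (by norm_num)

lemma cGrad {f g : V → ℝ} (hf : ContDiffOn ℝ 1 f Om) (hg : ContDiffOn ℝ 1 g Om) :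
    ContinuousOn (Grad f g) Om := by
  have h0 := c1X 0 hf
  have h1 := c1X 1 hf
  have h2 := c1X 2 hf
  have k0 := c1X 0 hg
  have k1 := c1X 1 hg
  have k2 := c1X 2 hg
  exact ((h0.mul k0).add (h1.mul k1)).add (h2.mul k2)

lemma c1Grad {f g : V → ℝ} (hf : ContDiffOn ℝ 2 f Om) (hg : ContDiffOn ℝ 2 g Om) :
    ContDiffOn ℝ 1 (Grad f g) Om := by
  have h0 := c2X 0 hf
  have h1 := c2X 1 hf
  have h2 := c2X 2 hf
  have k0 := c2X 0 hg
  have k1 := c2X 1 hg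
  have k2 := c2X 2 hg
  exact ((h0.mul k0).add (h1.mul k1)).add (h2.mul k2)

lemma cLap {f : V → ℝ} (hf : ContDiffOn ℝ 2 f Om) :
    ContinuousOn (Lap f) Om := by
  have h0 := c1X 0 (c2X 0 hf)
  have h1 := c1X 1 (c2X 1 hf)
  have h2 := c1X 2 (c2X 2 hf)
  exact (h0.add h1).add h2

lemma X_congr_ev (i : Fin 3) {f g : V → ℝ} {x : V} (h : f =ᶠ[nhds x] g) : X i f x = X i g x := by
  unfold X
  rw [h.fderiv_eq]

lemma XX_congr_ev (i j : Fin 3) {f g : V → ℝ} {x : V} (h : f =ᶠ[nhds x] g) :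
    X i (X j f) x = X i (X j g) x := by
  apply X_congr_ev
  filter_upwards [h.eventuallyEq_nhds] with y hy using X_congr_ev j hy

lemma XX_mul (i j : Fin 3) {f g : V → ℝ} {x : V} (hf : ContDiffAt ℝ 2 f x)
    (hg : ContDiffAt ℝ 2 g x) : X i (X j (fun y => f y * g y)) x =
      f x * X i (X j g) x + X i f x * X j g x + X j f x * X i g x + X i (X j f) x * g x := by
  have h : X j (fun y => f y * g y) =ᶠ[nhds x] fun y => f y * X j g y + X j f y * g y := by
    filter_upwards [evda hf, evda hg] with y h1 h2 using X_mul j h1 h2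
  rw [X_congr_ev i h, X_add i (f := fun y => f y * X j g y) (g := fun y => X j f y * g y)
    ((da hf).mul (daX j hg)) ((daX j hf).mul (da hg)),
    X_mul i (da hf) (daX j hg), X_mul i (daX j hf) (da hg)]
  ring

lemma XX_add (i j : Fin 3) {f g : V → ℝ} {x : V} (hf : ContDiffAt ℝ 2 f x)
    (hg : ContDiffAt ℝ 2 g x) : X i (X j (fun y => f y + g y)) x =
      X i (X j f) x + X i (X j g) x := by
  have h : X j (fun y => f y + g y) =ᶠ[nhds x] fun y => X j f y + X j g y := by
    filter_upwards [evda hf, evda hg] with y h1 h2 using X_add j h1 h2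
  rw [X_congr_ev i h, X_add i (daX j hf) (daX j hg)]

lemma X_const_fun (i : Fin 3) (c : ℝ) : X i (fun _ => c) = fun _ => 0 := by
  funext x; exact X_const i c x

lemma XX_smul (i j : Fin 3) (c : ℝ) {f : V → ℝ} {x : V} (hf : ContDiffAt ℝ 2 f x) :
    X i (X j (fun y => c * f y)) x = c * X i (X j f) x := by
  rw [XX_mul i j contDiffAt_const hf, X_const_fun, X_const_fun, X_const]; ring

lemma XX_comp (i j : Fin 3) {f : V → ℝ} {x : V} {φ φ1 : ℝ → ℝ} {φ2 : ℝ} (hf : ContDiffAt ℝ 2 f x)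
    (h1 : ∀ᶠ s in nhds (f x), HasDerivAt φ (φ1 s) s) (h2 : HasDerivAt φ1 φ2 (f x)) :
    X i (X j (fun y => φ (f y))) x = φ1 (f x) * X i (X j f) x + φ2 * X i f x * X j f x := by
  have h : X j (fun y => φ (f y)) =ᶠ[nhds x] fun y => φ1 (f y) * X j f y := by
    filter_upwards [evda hf, hf.continuousAt.eventually h1] with y h1 h2 using X_comp j h1 h2
  rw [X_congr_ev i h, X_mul i (f := fun y => φ1 (f y))
    (h2.comp_hasFDerivAt x (da hf).hasFDerivAt).differentiableAt (daX j hf), X_comp i (da hf) h2]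

lemma Lap_congr {f g : V → ℝ} (h : ∀ x ∈ Om, f x = g x) {x : V} (hx : x ∈ Om) :
    Lap f x = Lap g x := by
  have : f =ᶠ[nhds x] g := by
    filter_upwards [isOpen_Om.mem_nhds hx] with y hy using h y hy
  unfold Lap
  rw [XX_congr_ev _ _ this, XX_congr_ev _ _ this, XX_congr_ev _ _ this]

lemma Lap_mul {f g : V → ℝ} {x : V} (hf : ContDiffAt ℝ 2 f x)
    (hg : ContDiffAt ℝ 2 g x) : Lap (fun y => f y * g y) x =
      f x * Lap g x + 2 * Grad f g x + Lap f x * g x := by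
  unfold Lap Grad
  rw [XX_mul _ _ hf hg, XX_mul _ _ hf hg, XX_mul _ _ hf hg]
  ring

lemma Lap_add {f g : V → ℝ} {x : V} (hf : ContDiffAt ℝ 2 f x)
    (hg : ContDiffAt ℝ 2 g x) : Lap (fun y => f y + g y) x = Lap f x + Lap g x := by
  unfold Lap
  rw [XX_add _ _ hf hg, XX_add _ _ hf hg, XX_add _ _ hf hg]
  ring

lemma Lap_smul (c : ℝ) {f : V → ℝ} {x : V} (hf : ContDiffAt ℝ 2 f x) :
    Lap (fun y => c * f y) x = c * Lap f x := by
  unfold Lap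
  rw [XX_smul _ _ c hf, XX_smul _ _ c hf, XX_smul _ _ c hf]
  ring

lemma Lap_const (c : ℝ) (x : V) : Lap (fun _ => c) x = 0 := by
  unfold Lap
  simp [X_const_fun]

lemma Lap_comp {f : V → ℝ} {x : V} {φ φ1 : ℝ → ℝ} {φ2 : ℝ} (hf : ContDiffAt ℝ 2 f x)
    (h1 : ∀ᶠ s in nhds (f x), HasDerivAt φ (φ1 s) s) (h2 : HasDerivAt φ1 φ2 (f x)) :
    Lap (fun y => φ (f y)) x = φ1 (f x) * Lap f x + φ2 * Grad f f x := by
  unfold Lap Grad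
  rw [XX_comp _ _ hf h1 h2, XX_comp _ _ hf h1 h2, XX_comp _ _ hf h1 h2]
  ring

lemma Grad_comm (f g : V → ℝ) (x : V) : Grad f g x = Grad g f x := by
  unfold Grad; ring

lemma Grad_mul {f g h : V → ℝ} {x : V} (hf : DifferentiableAt ℝ f x)
    (hg : DifferentiableAt ℝ g x) : Grad h (fun y => f y * g y) x =
      f x * Grad h g x + Grad h f x * g x := by
  unfold Grad
  rw [X_mul _ hf hg, X_mul _ hf hg, X_mul _ hf hg]
  ring

lemma Grad_add {f g h : V → ℝ} {x : V} (hf : DifferentiableAt ℝ f x)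
    (hg : DifferentiableAt ℝ g x) : Grad h (fun y => f y + g y) x =
      Grad h f x + Grad h g x := by
  unfold Grad
  rw [X_add _ hf hg, X_add _ hf hg, X_add _ hf hg]
  ring

lemma Grad_smul (c : ℝ) {f h : V → ℝ} {x : V} (hf : DifferentiableAt ℝ f x) :
    Grad h (fun y => c * f y) x = c * Grad h f x := by
  unfold Grad
  rw [X_smul _ c hf, X_smul _ c hf, X_smul _ c hf]
  ring

lemma Grad_const (c : ℝ) {h : V → ℝ} {x : V} : Grad h (fun _ => c) x = 0 := by
  unfold Grad
  simp [X_const]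

lemma Grad_comp {f h : V → ℝ} {x : V} {φ : ℝ → ℝ} {φ' : ℝ} (hf : DifferentiableAt ℝ f x)
    (hφ : HasDerivAt φ φ' (f x)) : Grad h (fun y => φ (f y)) x = φ' * Grad h f x := by
  unfold Grad
  rw [X_comp _ hf hφ, X_comp _ hf hφ, X_comp _ hf hφ]
  ring

lemma Grad_congr {f g h : V → ℝ} (hfg : ∀ x ∈ Om, f x = g x) {x : V} (hx : x ∈ Om) :
    Grad h f x = Grad h g x := by
  unfold Grad
  rw [X_congr _ hfg hx, X_congr _ hfg hx, X_congr _ hfg hx]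

/-- divergence theorem, three components -/
lemma I_div {F a b c : V → ℝ} (ha : ContDiffOn ℝ 1 a Om) (hb : ContDiffOn ℝ 1 b Om)
    (hc : ContDiffOn ℝ 1 c Om) (h : ∀ x ∈ Om, F x = X 0 a x + X 1 b x + X 2 c x) : I F = 0 := by
  rw [I_lin3 1 1 1 (c1X 0 ha) (c1X 1 hb) (c1X 2 hc) (fun x hx => by rw [h x hx]; ring),
    I_X ha, I_X hb, I_X hc]
  ring

lemma Green {f g : V → ℝ} (hf : ContDiffOn ℝ 1 f Om) (hg : ContDiffOn ℝ 2 g Om) :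
    I (fun x => f x * Lap g x) = - I (Grad f g) := by
  have h : I (fun x => f x * Lap g x + Grad f g x) = 0 := by
    refine I_div (hf.mul (c2X 0 hg)) (hf.mul (c2X 1 hg)) (hf.mul (c2X 2 hg)) ?_
    intro x hx
    have h1 := diffAt one_ne_zero hf hx
    rw [X_mul 0 h1 (diffAt one_ne_zero (c2X 0 hg) hx), X_mul 1 h1 (diffAt one_ne_zero (c2X 1 hg) hx),
      X_mul 2 h1 (diffAt one_ne_zero (c2X 2 hg) hx)]
    unfold Lap Grad
    ring
  have := I_add (f := fun x => f x * Lap g x) (g := Grad f g)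
    (hf.continuousOn.mul (cLap hg)) (cGrad hf (c2c1 hg))
  linarith

lemma Green2 {f g : V → ℝ} (hf : ContDiffOn ℝ 2 f Om) (hg : ContDiffOn ℝ 2 g Om) :
    I (fun x => f x * Lap g x) = I (fun x => g x * Lap f x) := by
  rw [Green (c2c1 hf) hg, Green (c2c1 hg) hf, I_congr fun x _ => Grad_comm f g x]

/-! coordinates -/

lemma rr_pos {x : V} (hx : x ∈ Om) : 0 < rr x := Real.sqrt_pos.mpr (nsq_pos hx)

lemma cd_rr {n : WithTop ℕ∞} : ContDiffOn ℝ n rr Om := by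
  intro x hx
  exact ((contDiff_nsq.contDiffAt).sqrt (nsq_pos hx).ne').contDiffWithinAt

lemma cd_xi (i : Fin 3) {n : WithTop ℕ∞} : ContDiffOn ℝ n (xi i) Om := by
  unfold xi
  exact ContDiffOn.div (by fun_prop) cd_rr (fun x hx => (rr_pos hx).ne')

lemma X_rr (i : Fin 3) {x : V} (hx : x ∈ Om) : X i rr x = 0 := by
  have := X_comp i (f := nsq) (x := x) (contDiff_nsq (n := 1) |>.differentiable (by norm_num) x)
    (Real.hasDerivAt_sqrt (nsq_pos hx).ne')
  rw [X_nsq, mul_zero] at this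
  exact this

lemma X_coord (i j : Fin 3) (x : V) : X i (fun y => y j) x = rot i x j := by
  unfold X
  rw [(hasFDerivAt_apply (𝕜 := ℝ) j x).fderiv]
  rfl

lemma X_xi (i j : Fin 3) {x : V} (hx : x ∈ Om) :
    X i (xi j) x = rot i (fun k => xi k x) j := by
  have hr := (rr_pos hx).ne'
  have h := X_mul i (f := xi j) (g := rr) (x := x) (diffAt one_ne_zero (cd_xi j) hx)
    (diffAt one_ne_zero cd_rr hx)
  rw [X_rr i hx, mul_zero, zero_add, X_congr i (g := fun y => y j), X_coord] at h
  · have : rot i x j = rot i (fun k => xi k x) j * rr x := by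
      fin_cases i <;> fin_cases j <;> simp [rot, xi] <;> field_simp
    rw [this] at h
    exact (mul_right_cancel₀ hr h).symm
  · intro y hy
    have hr := (rr_pos hy).ne'
    simp only [xi]
    field_simp
  · exact hx

lemma xi_sq {x : V} (hx : x ∈ Om) : xi 0 x ^ 2 + xi 1 x ^ 2 + xi 2 x ^ 2 = 1 := by
  have hr : rr x ^ 2 = nsq x := Real.sq_sqrt (nsq_pos hx).le
  have h0 := (rr_pos hx).ne'
  unfold xi
  field_simp
  rw [hr]; rfl

lemma Xxi00 {x : V} (hx : x ∈ Om) : X 0 (xi 0) x = 0 := by rw [X_xi _ _ hx]; rfl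
lemma Xxi01 {x : V} (hx : x ∈ Om) : X 0 (xi 1) x = - xi 2 x := by rw [X_xi _ _ hx]; rfl
lemma Xxi02 {x : V} (hx : x ∈ Om) : X 0 (xi 2) x = xi 1 x := by rw [X_xi _ _ hx]; rfl
lemma Xxi10 {x : V} (hx : x ∈ Om) : X 1 (xi 0) x = xi 2 x := by rw [X_xi _ _ hx]; rfl
lemma Xxi11 {x : V} (hx : x ∈ Om) : X 1 (xi 1) x = 0 := by rw [X_xi _ _ hx]; rfl
lemma Xxi12 {x : V} (hx : x ∈ Om) : X 1 (xi 2) x = - xi 0 x := by rw [X_xi _ _ hx]; rfl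
lemma Xxi20 {x : V} (hx : x ∈ Om) : X 2 (xi 0) x = - xi 1 x := by rw [X_xi _ _ hx]; rfl
lemma Xxi21 {x : V} (hx : x ∈ Om) : X 2 (xi 1) x = xi 0 x := by rw [X_xi _ _ hx]; rfl
lemma Xxi22 {x : V} (hx : x ∈ Om) : X 2 (xi 2) x = 0 := by rw [X_xi _ _ hx]; rfl

def dl (i j : Fin 3) : ℝ := if i = j then 1 else 0

lemma Grad_xi (i j : Fin 3) {x : V} (hx : x ∈ Om) :
    Grad (xi i) (xi j) x = dl i j - xi i x * xi j x := by
  have h := xi_sq hx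
  unfold Grad
  rw [X_xi _ _ hx, X_xi _ _ hx, X_xi _ _ hx, X_xi _ _ hx, X_xi _ _ hx, X_xi _ _ hx]
  fin_cases i <;> fin_cases j <;> simp [rot, dl] <;> linarith

lemma XX_xi (i j k : Fin 3) {x : V} (hx : x ∈ Om) :
    X i (X j (xi k)) x = rot j (rot i (fun k => xi k x)) k := by
  have hd (k : Fin 3) : DifferentiableAt ℝ (xi k) x := diffAt one_ne_zero (cd_xi k) hx
  have hn (k : Fin 3) : X i (fun y => - xi k y) x = - X i (xi k) x := by
    have := X_smul i (-1) (hd k)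
    simpa using this
  rw [X_congr i (g := fun x => rot j (fun k => xi k x) k) (fun y hy => X_xi j k hy) hx]
  fin_cases j <;> fin_cases k <;> simp [rot, X_const, hn, X_xi _ _ hx]

lemma Lap_xi (k : Fin 3) {x : V} (hx : x ∈ Om) : Lap (xi k) x = -2 * xi k x := by
  unfold Lap
  rw [XX_xi _ _ _ hx, XX_xi _ _ _ hx, XX_xi _ _ _ hx]
  fin_cases k <;> simp [rot] <;> ring

/-! commutators -/
lemma XX_formula (i j : Fin 3) {f : V → ℝ} {x : V} (hf : ContDiffAt ℝ 2 f x) :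
    X i (X j f) x = fderiv ℝ (fderiv ℝ f) x (rot i x) (rot j x)
      + fderiv ℝ f x (rot j (rot i x)) := by
  have h1 : DifferentiableAt ℝ (fderiv ℝ f) x :=
    (hf.fderiv_right (m := 1) (by norm_num)).differentiableAt (by norm_num)
  have h2 : HasFDerivAt (rot j) (fderiv ℝ (rot j) x) x :=
    ((contDiff_rot j (n := 1)).differentiable (by norm_num) x).hasFDerivAt
  have h3 : fderiv ℝ (rot j) x (rot i x) = rot j (rot i x) := by
    funext k
    have hk : fderiv ℝ (rot j) x (rot i x) k = fderiv ℝ (fun y => rot j y k) x (rot i x) := by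
      rw [fderiv_pi (fun k => by
        exact (contDiff_pi.mp (contDiff_rot j (n := 1)) k).differentiable (by norm_num) x)]
      rfl
    rw [hk]
    have hX : fderiv ℝ (fun y => rot j y k) x (rot i x) = X i (fun y => rot j y k) x := rfl
    rw [hX]
    have hn (k : Fin 3) : X i (fun y => - y k) x = - rot i x k := by
      rw [← X_coord, ← neg_one_mul, ← X_smul i (-1) (by fun_prop)]
      simp
    fin_cases i <;> fin_cases j <;> fin_cases k <;> simp [rot, X_const, X_coord] <;>
      exact (hn _).trans (by simp [rot])
  have h4 := (h1.hasFDerivAt.clm_apply h2)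
  have : X i (X j f) x = fderiv ℝ (fun y => fderiv ℝ f y (rot j y)) x (rot i x) := rfl
  rw [this, h4.fderiv]
  simp only [add_apply, ContinuousLinearMap.comp_apply, h3,
    ContinuousLinearMap.flip_apply]
  ring

lemma comm_gen (i j k : Fin 3) {f : V → ℝ} {x : V} (hf : ContDiffAt ℝ 2 f x)
    (hr : rot j (rot i x) - rot i (rot j x) = - rot k x) :
    X i (X j f) x = X j (X i f) x - X k f x := by
  rw [XX_formula i j hf, XX_formula j i hf]
  have hs := (hf.isSymmSndFDerivAt (by simp)).eq (rot i x) (rot j x)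
  have h2 : fderiv ℝ f x (rot j (rot i x)) - fderiv ℝ f x (rot i (rot j x)) = - X k f x := by
    rw [← map_sub, hr, map_neg]; rfl
  linarith

lemma comm01 {f : V → ℝ} {x : V} (hf : ContDiffAt ℝ 2 f x) :
    X 0 (X 1 f) x = X 1 (X 0 f) x - X 2 f x := by
  apply comm_gen 0 1 2 hf
  funext k; fin_cases k <;> simp [rot]
lemma comm12 {f : V → ℝ} {x : V} (hf : ContDiffAt ℝ 2 f x) :
    X 1 (X 2 f) x = X 2 (X 1 f) x - X 0 f x := by
  apply comm_gen 1 2 0 hf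
  funext k; fin_cases k <;> simp [rot]
lemma comm20 {f : V → ℝ} {x : V} (hf : ContDiffAt ℝ 2 f x) :
    X 2 (X 0 f) x = X 0 (X 2 f) x - X 1 f x := by
  apply comm_gen 2 0 1 hf
  funext k; fin_cases k <;> simp [rot]

lemma xi_perp (f : V → ℝ) (x : V) :
    xi 0 x * X 0 f x + xi 1 x * X 1 f x + xi 2 x * X 2 f x = 0 := by
  unfold X
  rw [← smul_eq_mul, ← smul_eq_mul, ← smul_eq_mul, ← map_smul, ← map_smul, ← map_smul,
    ← map_add, ← map_add]
  have : xi 0 x • rot 0 x + xi 1 x • rot 1 x + xi 2 x • rot 2 x = 0 := by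
    funext k; fin_cases k <;> simp [rot, xi] <;> ring
  rw [this, map_zero]

end MF

namespace MF

lemma X_pair (i : Fin 3) {h : ℝ × ℝ → ℝ} {p q : V → ℝ} {x : V}
    (hh : DifferentiableAt ℝ h (p x, q x)) (hp : DifferentiableAt ℝ p x)
    (hq : DifferentiableAt ℝ q x) :
    X i (fun y => h (p y, q y)) x =
      fderiv ℝ h (p x, q x) (1, 0) * X i p x + fderiv ℝ h (p x, q x) (0, 1) * X i q x := by
  unfold X
  have h1 : HasFDerivAt (fun y => (p y, q y)) ((fderiv ℝ p x).prod (fderiv ℝ q x)) x :=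
    hp.hasFDerivAt.prodMk hq.hasFDerivAt
  have h2 := (hh.hasFDerivAt (x := (p x, q x))).comp x h1
  have h3 : fderiv ℝ (fun y => h (p y, q y)) x = _ := h2.fderiv
  rw [h3]
  have : (fderiv ℝ p x (rot i x), fderiv ℝ q x (rot i x))
      = fderiv ℝ p x (rot i x) • ((1:ℝ), (0:ℝ)) + fderiv ℝ q x (rot i x) • ((0:ℝ), (1:ℝ)) := by simp
  simp only [ContinuousLinearMap.comp_apply, ContinuousLinearMap.prod_apply]
  rw [this, map_add, map_smul, map_smul]
  simp only [smul_eq_mul]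
  ring

lemma XX_pair (i : Fin 3) {h : ℝ × ℝ → ℝ} {p q : V → ℝ} {x : V}
    (hh : ContDiff ℝ 2 h) (hp : ContDiffAt ℝ 2 p x) (hq : ContDiffAt ℝ 2 q x) :
    X i (X i (fun y => h (p y, q y))) x =
      fderiv ℝ h (p x, q x) (1, 0) * X i (X i p) x + fderiv ℝ h (p x, q x) (0, 1) * X i (X i q) x
      + fderiv ℝ (fderiv ℝ h) (p x, q x) (1, 0) (1, 0) * X i p x ^ 2
      + 2 * (fderiv ℝ (fderiv ℝ h) (p x, q x) (1, 0) (0, 1) * X i p x * X i q x)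
      + fderiv ℝ (fderiv ℝ h) (p x, q x) (0, 1) (0, 1) * X i q x ^ 2 := by
  have hd : ∀ z, DifferentiableAt ℝ h z := fun z => hh.differentiable (by norm_num) z
  have hd1 : ContDiff ℝ 1 (fderiv ℝ h) := hh.fderiv_right (by norm_num)
  have hd2 : ∀ z, DifferentiableAt ℝ (fderiv ℝ h) z := fun z => hd1.differentiable (by norm_num) z
  have hfv (v : ℝ × ℝ) (z w) : fderiv ℝ (fun z => fderiv ℝ h z v) z w
      = fderiv ℝ (fderiv ℝ h) z w v := by
    rw [fderiv_clm_apply (hd2 z) (by fun_prop)]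
    simp
  have hdv (v : ℝ × ℝ) (z) : DifferentiableAt ℝ (fun z => fderiv ℝ h z v) z :=
    (hd2 z).clm_apply (by fun_prop)
  have hev : X i (fun y => h (p y, q y)) =ᶠ[nhds x] fun y =>
      (fun z => fderiv ℝ h z (1, 0)) (p y, q y) * X i p y
        + (fun z => fderiv ℝ h z (0, 1)) (p y, q y) * X i q y := by
    filter_upwards [evda hp, evda hq] with y h1 h2 using X_pair i (hd _) h1 h2
  have hdp (v : ℝ × ℝ) : DifferentiableAt ℝ (fun y => (fun z => fderiv ℝ h z v) (p y, q y)) x :=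
    DifferentiableAt.comp x (f := fun y => (p y, q y)) (hdv v _) ((da hp).prodMk (da hq))
  rw [X_congr_ev i hev, X_add i (f := fun y => (fun z => fderiv ℝ h z (1, 0)) (p y, q y) * X i p y)
      (g := fun y => (fun z => fderiv ℝ h z (0, 1)) (p y, q y) * X i q y)
      ((hdp _).mul (daX i hp)) ((hdp _).mul (daX i hq)),
    X_mul i (hdp _) (daX i hp), X_mul i (hdp _) (daX i hq),
    X_pair i (hdv _ _) (da hp) (da hq), X_pair i (hdv _ _) (da hp) (da hq)]
  rw [hfv, hfv, hfv, hfv]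
  have hs := ((hh.contDiffAt (x := (p x, q x))).isSymmSndFDerivAt (by simp)).eq (1, 0) (0, 1)
  rw [hs]
  ring

lemma lap_eq {h : ℝ × ℝ → ℝ} (z : ℝ × ℝ) : lap h z =
    fderiv ℝ (fderiv ℝ h) z (1, 0) (1, 0) + fderiv ℝ (fderiv ℝ h) z (0, 1) (0, 1) := by
  unfold lap
  rw [iteratedFDeriv_two_apply, iteratedFDeriv_two_apply]
  rfl

lemma Lap_pair {h : ℝ × ℝ → ℝ} {p q : V → ℝ} {x : V} {m : ℝ}
    (hh : ContDiff ℝ 2 h) (hp : ContDiffAt ℝ 2 p x) (hq : ContDiffAt ℝ 2 q x)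
    (lp : Lap p x = 0) (lq : Lap q x = 0) (gp : Grad p p x = m) (gq : Grad q q x = m)
    (gpq : Grad p q x = 0) :
    Lap (fun y => h (p y, q y)) x = m * lap h (p x, q x) := by
  rw [lap_eq]
  unfold Lap Grad at *
  rw [XX_pair 0 hh hp hq, XX_pair 1 hh hp hq, XX_pair 2 hh hp hq]
  set A := fderiv ℝ (fderiv ℝ h) (p x, q x) (1, 0) (1, 0)
  set B := fderiv ℝ (fderiv ℝ h) (p x, q x) (1, 0) (0, 1)
  set C := fderiv ℝ (fderiv ℝ h) (p x, q x) (0, 1) (0, 1)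
  linear_combination (fderiv ℝ h (p x, q x) (1, 0)) * lp + (fderiv ℝ h (p x, q x) (0, 1)) * lq
    + A * gp + C * gq + 2 * B * gpq

lemma chart_facts {s : ℝ} (hs : s ^ 2 = 1) {x : V} (hx : x ∈ Om) (hne : 1 - s * xi 2 x ≠ 0) :
    ∃ k : V → ℝ, (∀ y, k y = (1 - s * xi 2 y)⁻¹) ∧ ContDiffAt ℝ 2 k x ∧
     ∀ a b : Fin 3, a ≠ 2 → b ≠ 2 → 
      Lap (fun y => xi a y * k y) x = 0 ∧
      Grad (fun y => xi a y * k y) (fun y => xi b y * k y) x = dl a b * k x ^ 2 := by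
  refine ⟨fun y => (1 - s * xi 2 y)⁻¹, fun y => rfl, ?_, ?_⟩
  · exact (contDiffAt_const.sub (contDiffAt_const.mul (cdat (cd_xi 2) hx))).inv hne
  intro a b ha hb
  set k : V → ℝ := fun y => (1 - s * xi 2 y)⁻¹ with hk
  have hkc : ContDiffAt ℝ 2 k x :=
    (contDiffAt_const.sub (contDiffAt_const.mul (cdat (cd_xi 2) hx))).inv hne
  have hxi (j : Fin 3) : ContDiffAt ℝ 2 (xi j) x := cdat (cd_xi j) hx
  have hkx : k x * (1 - s * xi 2 x) = 1 := inv_mul_cancel₀ hne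
  have hD : ∀ t : ℝ, 1 - s * t ≠ 0 → HasDerivAt (fun t : ℝ => (1 - s * t)⁻¹) (s * ((1 - s * t)⁻¹) ^ 2) t := by
    intro t ht
    have h1 : HasDerivAt (fun t : ℝ => 1 - s * t) (-s) t := by
      simpa using ((hasDerivAt_id t).const_mul s).const_sub 1
    have h2 := h1.inv ht
    have e : s * ((1 - s * t)⁻¹) ^ 2 = - -s / (1 - s * t) ^ 2 := by field_simp
    rw [e]
    exact h2
  have hev : ∀ᶠ t in nhds (xi 2 x), 1 - s * t ≠ 0 := by
    have : ContinuousAt (fun t : ℝ => 1 - s * t) (xi 2 x) := by fun_prop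
    exact this.eventually_ne hne
  have hD2 : HasDerivAt (fun t : ℝ => s * ((1 - s * t)⁻¹) ^ 2) (2 * k x ^ 3) (xi 2 x) := by
    have h2 := ((hD _ hne).pow 2).const_mul s
    refine h2.congr_deriv ?_
    simp only [hk]
    push_cast
    linear_combination (2 * ((1 - s * xi 2 x)⁻¹) ^ 3) * hs
  have hG (h : V → ℝ) : Grad h k x = s * k x ^ 2 * Grad h (xi 2) x :=
    Grad_comp (φ := fun t : ℝ => (1 - s * t)⁻¹) (da (hxi 2)) (hD _ hne)
  have hL : Lap k x = s * k x ^ 2 * Lap (xi 2) x + 2 * k x ^ 3 * Grad (xi 2) (xi 2) x :=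
    Lap_comp (φ := fun t : ℝ => (1 - s * t)⁻¹) (hxi 2) (hev.mono fun t ht => hD t ht) hD2
  have e1 : dl a 2 = 0 := by simp [dl, ha]
  have e2 : dl b 2 = 0 := by simp [dl, hb]
  have e3 : dl (2 : Fin 3) 2 = 1 := by simp [dl]
  constructor
  · rw [Lap_mul (hxi a) hkc, hL, hG, Lap_xi _ hx, Lap_xi _ hx, Grad_xi _ _ hx, Grad_xi _ _ hx, e1, e3]
    have hcc : xi 2 x ^ 2 = (s * xi 2 x) ^ 2 := by rw [mul_pow, hs, one_mul]
    generalize k x = K at *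
    generalize xi 2 x = c at *
    generalize xi a x = d at *
    linear_combination (-2 * d * K ^ 3) * hcc + d * (4 * K ^ 2 - 2 * K * (K * (1 - s * c) - 1)) * hkx
  · have h1 : Grad (fun y => xi a y * k y) (xi b) x = xi a x * (s * k x ^ 2 * (- xi b x * xi 2 x))
        + k x * (dl a b - xi a x * xi b x) := by
      rw [Grad_comm, Grad_mul (da (hxi a)) (da hkc), hG, Grad_xi _ _ hx, Grad_xi _ _ hx, e2]
      have : dl b a = dl a b := by simp [dl, eq_comm]
      rw [this]
      ring
    have h2 : Grad (fun y => xi a y * k y) k x = s * k x ^ 2 * (xi a x * s * k x ^ 2 * (1 - xi 2 x ^ 2)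
        - k x * xi a x * xi 2 x) := by
      rw [hG, Grad_comm, Grad_mul (da (hxi a)) (da hkc), hG, Grad_xi _ _ hx, Grad_xi _ _ hx, e3,
        show dl 2 a = 0 by simp [dl, ha.symm]]
      ring
    rw [Grad_mul (da (hxi b)) (da hkc), h1, h2]
    generalize k x = K at *
    generalize xi 2 x = c at *
    generalize xi a x = d at *
    generalize xi b x = e at *
    linear_combination (d * e * K ^ 4) * hs + d * e * (2 * K ^ 3 - K ^ 2 * (K * (1 - s * c) - 1)) * hkx

def utl (u : V → ℝ) (x : V) : ℝ := u (fun k => xi k x)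

lemma chart_main {s : ℝ} (hs : s ^ 2 = 1) {x : V} (hx : x ∈ Om) (hne : 1 - s * xi 2 x ≠ 0)
    (u : V → ℝ) (st : ℝ × ℝ → V) (hC : ContDiff ℝ 2 (fun z => u (st z)))
    (hE : ∀ y : ℝ × ℝ, lap (fun z => u (st z)) y =
      4 * 6 * (1 - Real.exp (u (st y))) / (1 + y.1 ^ 2 + y.2 ^ 2) ^ 2)
    (hst : ∀ y ∈ Om, ∀ k : ℝ, k * (1 - s * xi 2 y) = 1 →
      st (xi 0 y * k, xi 1 y * k) = fun j => xi j y) :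
    ContDiffAt ℝ 2 (utl u) x ∧ Lap (utl u) x = 6 * (1 - Real.exp (utl u x)) := by
  obtain ⟨k, hk, hkc, hf⟩ := chart_facts hs hx hne
  have hxi (j : Fin 3) : ContDiffAt ℝ 2 (xi j) x := cdat (cd_xi j) hx
  have hev : utl u =ᶠ[nhds x] fun y => (fun z => u (st z)) (xi 0 y * k y, xi 1 y * k y) := by
    have hc : ContinuousAt (fun y => 1 - s * xi 2 y) x :=
      (contDiffAt_const.sub (contDiffAt_const.mul (hxi 2))).continuousAt
    filter_upwards [isOpen_Om.mem_nhds hx, hc.eventually_ne hne] with y hy hny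
    simp only [utl]
    rw [hst y hy (k y) (by rw [hk]; exact inv_mul_cancel₀ hny)]
  have hkx : k x * (1 - s * xi 2 x) = 1 := by rw [hk]; exact inv_mul_cancel₀ hne
  have hk0 : k x ≠ 0 := left_ne_zero_of_mul_eq_one hkx
  constructor
  · refine ContDiffAt.congr_of_eventuallyEq ?_ hev
    exact ContDiffAt.comp x (f := fun y => (xi 0 y * k y, xi 1 y * k y)) hC.contDiffAt
      (((hxi 0).mul hkc).prodMk ((hxi 1).mul hkc))
  · have h1 : Lap (utl u) x = Lap (fun y => (fun z => u (st z)) (xi 0 y * k y, xi 1 y * k y)) x := by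
      unfold Lap
      rw [XX_congr_ev _ _ hev, XX_congr_ev _ _ hev, XX_congr_ev _ _ hev]
    rw [h1, Lap_pair (m := k x ^ 2) hC ((hxi 0).mul hkc) ((hxi 1).mul hkc)
      (hf 0 0 (by decide) (by decide)).1 (hf 1 1 (by decide) (by decide)).1
      (by rw [(hf 0 0 (by decide) (by decide)).2]; simp [dl])
      (by rw [(hf 1 1 (by decide) (by decide)).2]; simp [dl])
      (by rw [(hf 0 1 (by decide) (by decide)).2]; simp [dl]), hE, hst x hx (k x) hkx]
    have h2 : 1 + (xi 0 x * k x) ^ 2 + (xi 1 x * k x) ^ 2 = 2 * k x := by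
      have h3 := xi_sq hx
      have hcc : xi 2 x ^ 2 = (s * xi 2 x) ^ 2 := by rw [mul_pow, hs, one_mul]
      linear_combination k x ^ 2 * h3 - k x ^ 2 * hcc + (-k x * (1 - s * xi 2 x) +2 * k x - 1) * hkx
    simp only [utl]
    rw [h2]
    field_simp
    ring

lemma utl_facts {u : V → ℝ} (hu : IsMFSolution 6 u) :
    ContDiffOn ℝ 2 (utl u) Om ∧ ∀ x ∈ Om, Lap (utl u) x = 6 * (1 - Real.exp (utl u x)) := by
  have key : ∀ x ∈ Om, ContDiffAt ℝ 2 (utl u) x ∧ Lap (utl u) x = 6 * (1 - Real.exp (utl u x)) := by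
    intro x hx
    obtain ⟨-, h1, h2, h3, h4⟩ := hu
    by_cases hc : 1 - 1 * xi 2 x ≠ 0
    · refine chart_main (s := 1) (by norm_num) hx hc u stereoN h1 h3 ?_
      intro y hy k hk
      have hs := xi_sq hy
      have hk0 : k ≠ 0 := left_ne_zero_of_mul_eq_one hk
      have h2 : 1 + (xi 0 y * k) ^ 2 + (xi 1 y * k) ^ 2 = 2 * k := by
        linear_combination k ^ 2 * hs + (-k * (1 - xi 2 y) +2 * k - 1) * hk
      funext j
      fin_cases j
      · simp only [stereoN]; rw [h2]; simp; field_simp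
      · simp only [stereoN]; rw [h2]; simp; field_simp
      · simp only [stereoN]; rw [h2]; simp; field_simp
        linear_combination h2 + 2 * hk
    · refine chart_main (s := -1) (by norm_num) hx ?_ u stereoS h2 h4 ?_
      · push Not at hc
        intro h
        linarith
      intro y hy k hk
      have hs := xi_sq hy
      have hk0 : k ≠ 0 := left_ne_zero_of_mul_eq_one hk
      have h2 : 1 + (xi 0 y * k) ^ 2 + (xi 1 y * k) ^ 2 = 2 * k := by
        linear_combination k ^ 2 * hs + (-k * (1 + xi 2 y) +2 * k - 1) * hk
      funext j
      fin_cases j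
      · simp only [stereoS]; rw [h2]; simp; field_simp
      · simp only [stereoS]; rw [h2]; simp; field_simp
      · simp only [stereoS]; rw [h2]; simp; field_simp
        linear_combination - h2 - 2 * hk
  exact ⟨fun x hx => (key x hx).1.contDiffWithinAt, fun x hx => (key x hx).2⟩

lemma rr_smul {c : ℝ} (hc : 0 < c) (x : V) : rr (c • x) = c * rr x := by
  unfold rr
  have : nsq (c • x) = c ^ 2 * nsq x := by simp [nsq]; ring
  rw [this, Real.sqrt_mul (sq_nonneg c), Real.sqrt_sq hc.le]

lemma xi_hom (i : Fin 3) : Hom (xi i) := by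
  intro c hc x hx
  have := (rr_pos hx).ne'
  simp only [xi]
  rw [rr_smul hc]
  simp
  field_simp

lemma utl_hom (u : V → ℝ) : Hom (utl u) := by
  intro c hc x hx
  unfold utl
  congr 1
  funext k
  exact xi_hom k c hc x hx

lemma xi_of_sphere {x : V} (hx : x ∈ sphere3) : (fun k => xi k x) = x := by
  have : rr x = 1 := by
    unfold rr nsq; rw [show x 0 ^ 2 + x 1 ^ 2 + x 2 ^ 2 = 1 from hx]; simp
  funext k
  simp [xi, this]

lemma sphere_Om {x : V} (hx : x ∈ sphere3) : x ∈ Om := by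
  intro h
  subst h
  simp [sphere3] at hx

lemma xi_mem_sphere {x : V} (hx : x ∈ Om) : (fun k => xi k x) ∈ sphere3 := xi_sq hx

lemma xi_neg (i : Fin 3) (x : V) : xi i (-x) = - xi i x := by
  simp [xi, rr, nsq_neg, neg_div]

end MF

namespace MF

/-- continuous functions on the punctured space -/
def A : Subalgebra ℝ (V → ℝ) where
  carrier := {f | ContinuousOn f Om}
  mul_mem' := fun ha hb => ContinuousOn.mul ha hb
  add_mem' := fun ha hb => ContinuousOn.add ha hb
  algebraMap_mem' := fun _ => continuousOn_const

def xiA (i : Fin 3) : A := ⟨xi i, (cd_xi i (n := 0)).continuousOn⟩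

/-- polynomials of degree at most `n` in the coordinates -/
def P : ℕ → Submodule ℝ A
  | 0 => Submodule.span ℝ {1}
  | n + 1 => P n ⊔ ((P n).map (LinearMap.mulLeft ℝ (xiA 0)) ⊔ ((P n).map (LinearMap.mulLeft ℝ (xiA 1))
      ⊔ (P n).map (LinearMap.mulLeft ℝ (xiA 2))))

def Pm : ℕ → Submodule ℝ A
  | 0 => ⊥
  | n + 1 => P n

lemma P_fin (n : ℕ) : Module.Finite ℝ (P n) := by
  induction n with
  | zero => exact (inferInstance : Module.Finite ℝ (Submodule.span ℝ {(1 : A)}))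
  | succ n ih =>
    exact (inferInstance : Module.Finite ℝ ↥(P n ⊔ ((P n).map (LinearMap.mulLeft ℝ (xiA 0)) ⊔
      ((P n).map (LinearMap.mulLeft ℝ (xiA 1)) ⊔ (P n).map (LinearMap.mulLeft ℝ (xiA 2))))))

lemma P_mono_succ (n : ℕ) : P n ≤ P (n + 1) := by
  conv_rhs => unfold P
  exact le_sup_left

lemma P_mono {n m : ℕ} (h : n ≤ m) : P n ≤ P m := monotone_nat_of_le_succ P_mono_succ h

lemma one_mem_P : (1 : A) ∈ P 0 := Submodule.mem_span_singleton_self 1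

lemma xi_mul_mem {n : ℕ} (i : Fin 3) {p : A} (hp : p ∈ P n) : xiA i * p ∈ P (n + 1) := by
  unfold P
  have h : xiA i * p ∈ (P n).map (LinearMap.mulLeft ℝ (xiA i)) := ⟨p, hp, rfl⟩
  fin_cases i
  · exact Submodule.mem_sup_right (Submodule.mem_sup_left h)
  · exact Submodule.mem_sup_right (Submodule.mem_sup_right (Submodule.mem_sup_left h))
  · exact Submodule.mem_sup_right (Submodule.mem_sup_right (Submodule.mem_sup_right h))

/-- induction principle -/
lemma P_induction {C : ℕ → A → Prop} (h0 : ∀ c : ℝ, C 0 (c • 1))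
    (hs : ∀ n p, p ∈ P n → C n p → C (n + 1) p)
    (hx : ∀ n p i, p ∈ P n → C n p → C (n + 1) (xiA i * p))
    (ha : ∀ n p q, p ∈ P n → q ∈ P n → C n p → C n q → C n (p + q)) (n : ℕ) :
    ∀ p ∈ P n, C n p := by
  induction n with
  | zero =>
    intro p hp
    obtain ⟨c, rfl⟩ := Submodule.mem_span_singleton.mp hp
    exact h0 c
  | succ n ih =>
    intro p hp
    unfold P at hp
    obtain ⟨a, ha', b, hb, rfl⟩ := Submodule.mem_sup.mp hp
    obtain ⟨b0, ⟨c0, hc0, rfl⟩, b', hb', rfl⟩ := Submodule.mem_sup.mp hb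
    obtain ⟨b1, ⟨c1, hc1, rfl⟩, b2, ⟨c2, hc2, rfl⟩, rfl⟩ := Submodule.mem_sup.mp hb'
    have hm (i : Fin 3) (c : A) (hc : c ∈ P n) : xiA i * c ∈ P (n + 1) ∧ C (n + 1) (xiA i * c) :=
      ⟨xi_mul_mem i hc, hx n c i hc (ih c hc)⟩
    have m12 : xiA 1 * c1 + xiA 2 * c2 ∈ P (n + 1) := (P (n+1)).add_mem (hm 1 c1 hc1).1 (hm 2 c2 hc2).1
    have p12 : C (n + 1) (xiA 1 * c1 + xiA 2 * c2) :=
      ha _ _ _ (hm 1 c1 hc1).1 (hm 2 c2 hc2).1 (hm 1 c1 hc1).2 (hm 2 c2 hc2).2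
    exact ha _ _ _ (P_mono_succ n ha') ((P (n+1)).add_mem (hm 0 c0 hc0).1 m12)
      (hs _ _ ha' (ih a ha')) (ha _ _ _ (hm 0 c0 hc0).1 m12 (hm 0 c0 hc0).2 p12)

lemma P_smooth (n : ℕ) : ∀ p ∈ P n, ContDiffOn ℝ 2 (p : V → ℝ) Om ∧ Hom p := by
  refine P_induction (C := fun _ p => ContDiffOn ℝ 2 (p : V → ℝ) Om ∧ Hom p) ?_ ?_ ?_ ?_ n
  · intro c
    have : ((c • 1 : A) : V → ℝ) = fun _ => c := by funext x; simp
    rw [this]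
    exact ⟨contDiffOn_const, fun c hc x hx => rfl⟩
  · intro n p _ h; exact h
  · intro n p i _ h
    refine ⟨(cd_xi i).mul h.1, fun c hc x hx => ?_⟩
    show xi i (c • x) * (p : V → ℝ) (c • x) = xi i x * (p : V → ℝ) x
    rw [xi_hom i c hc x hx, h.2 c hc x hx]
  · intro n p q _ _ hp hq
    refine ⟨hp.1.add hq.1, fun c hc x hx => ?_⟩
    show (p : V → ℝ) (c • x) + (q : V → ℝ) (c • x) = (p : V → ℝ) x + (q : V → ℝ) x
    rw [hp.2 c hc x hx, hq.2 c hc x hx]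

lemma P_mul {m : ℕ} {q : A} (hq : q ∈ P m) (n : ℕ) : ∀ p ∈ P n, p * q ∈ P (n + m) := by
  refine P_induction (C := fun n p => p * q ∈ P (n + m)) ?_ ?_ ?_ ?_ n
  · intro c
    rw [zero_add, smul_mul_assoc, one_mul]
    exact (P m).smul_mem c hq
  · intro n p _ h; exact P_mono (by omega) h
  · intro n p i _ h
    rw [mul_assoc, show n + 1 + m = n + m + 1 by ring]
    exact xi_mul_mem i h
  · intro n p q' _ _ hp hq'
    rw [add_mul]
    exact (P (n + m)).add_mem hp hq'

lemma Pm_le (n : ℕ) : Pm n ≤ P n := by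
  cases n with
  | zero => exact bot_le
  | succ n => exact P_mono_succ n

lemma xi_Pm {n : ℕ} (i : Fin 3) {p : A} (hp : p ∈ Pm n) : xiA i * p ∈ P n := by
  cases n with
  | zero =>
    have : p = 0 := hp
    rw [this, mul_zero]; exact (P 0).zero_mem
  | succ n => exact xi_mul_mem i hp

lemma P_Grad (n : ℕ) : ∀ p ∈ P n, ∀ i, ∃ r ∈ P n, ∀ x ∈ Om,
    Grad (xi i) p x = - n * (xi i x * p.1 x) + r.1 x := by
  refine P_induction (C := fun n p => ∀ i, ∃ r ∈ P n, ∀ x ∈ Om,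
    Grad (xi i) p x = - n * (xi i x * p.1 x) + r.1 x) ?_ ?_ ?_ ?_ n
  · intro c i
    refine ⟨0, (P 0).zero_mem, fun x _ => ?_⟩
    have : ((c • 1 : A) : V → ℝ) = fun _ => c := by funext x; simp
    rw [this, Grad_const]; simp
  · intro n p hp h i
    obtain ⟨r, hr, h⟩ := h i
    refine ⟨xiA i * p + r, (P (n+1)).add_mem (xi_mul_mem i hp) (P_mono_succ n hr), fun x hx => ?_⟩
    rw [h x hx]
    show _ = _ + (xi i x * p.1 x + r.1 x)
    push_cast; ring
  · intro n p k hp h i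
    obtain ⟨r, hr, h⟩ := h i
    refine ⟨dl i k • p + xiA k * r, (P (n+1)).add_mem ((P (n+1)).smul_mem _ (P_mono_succ n hp))
      (xi_mul_mem k hr), fun x hx => ?_⟩
    have e : Grad (xi i) (xiA k * p : A) x = Grad (xi i) (fun y => xi k y * p.1 y) x := rfl
    rw [e, Grad_mul (da (cdat (cd_xi k) hx)) (da (cdat (P_smooth n p hp).1 hx)), h x hx, Grad_xi _ _ hx]
    show _ = _ * (_ * (xi k x * p.1 x)) + (dl i k * p.1 x + xi k x * r.1 x)
    push_cast; ring
  · intro n p q hp hq h1 h2 i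
    obtain ⟨r, hr, h1⟩ := h1 i
    obtain ⟨r2, hr2, h2⟩ := h2 i
    refine ⟨r + r2, (P n).add_mem hr hr2, fun x hx => ?_⟩
    have e : Grad (xi i) (p + q : A) x = Grad (xi i) (fun y => p.1 y + q.1 y) x := rfl
    rw [e, Grad_add (da (cdat (P_smooth n p hp).1 hx)) (da (cdat (P_smooth n q hq).1 hx)), h1 x hx, h2 x hx]
    show _ = _ * (_ * (p.1 x + q.1 x)) + (r.1 x + r2.1 x)
    ring

lemma P_Lap (n : ℕ) : ∀ p ∈ P n, ∃ r ∈ Pm n, ∀ x ∈ Om,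
    Lap p x = - (n * (n + 1)) * p.1 x + r.1 x := by
  refine P_induction (C := fun n p => ∃ r ∈ Pm n, ∀ x ∈ Om,
    Lap p x = - (n * (n + 1)) * p.1 x + r.1 x) ?_ ?_ ?_ ?_ n
  · intro c
    refine ⟨0, (Pm 0).zero_mem, fun x _ => ?_⟩
    have : ((c • 1 : A) : V → ℝ) = fun _ => c := by funext x; simp
    rw [this, Lap_const]; simp
  · intro n p hp h
    obtain ⟨r, hr, h⟩ := h
    refine ⟨(2 * ((n:ℝ) + 1)) • p + r, (P n).add_mem ((P n).smul_mem _ hp) (Pm_le n hr), fun x hx => ?_⟩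
    rw [h x hx]
    show _ = _ + (_ * p.1 x + r.1 x)
    push_cast; ring
  · intro n p k hp h
    obtain ⟨r, hr, h⟩ := h
    obtain ⟨r', hr', h'⟩ := P_Grad n p hp k
    refine ⟨(2:ℝ) • r' + xiA k * r, (P n).add_mem ((P n).smul_mem _ hr') (xi_Pm k hr), fun x hx => ?_⟩
    have e : Lap (xiA k * p : A) x = Lap (fun y => xi k y * p.1 y) x := rfl
    rw [e, Lap_mul (cdat (cd_xi k) hx) (cdat (P_smooth n p hp).1 hx), h x hx, h' x hx, Lap_xi _ hx]
    show _ = _ * (xi k x * p.1 x) + (2 * r'.1 x + xi k x * r.1 x)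
    push_cast; ring
  · intro n p q hp hq h1 h2
    obtain ⟨r, hr, h1⟩ := h1
    obtain ⟨r2, hr2, h2⟩ := h2
    refine ⟨r + r2, (Pm n).add_mem hr hr2, fun x hx => ?_⟩
    have e : Lap (p + q : A) x = Lap (fun y => p.1 y + q.1 y) x := rfl
    rw [e, Lap_add (cdat (P_smooth n p hp).1 hx) (cdat (P_smooth n q hq).1 hx), h1 x hx, h2 x hx]
    show _ = _ * (p.1 x + q.1 x) + (r.1 x + r2.1 x)
    ring

/-- harmonic part: eigenfunctions -/
lemma P_eigen {n : ℕ} {q : A} (hq : q ∈ P (n + 1)) (ho : ∀ p ∈ P n, I (fun x => p.1 x * q.1 x) = 0) :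
    ∀ x ∈ Om, Lap q x = - ((n + 1) * (n + 2)) * q.1 x := by
  obtain ⟨r, hr, h⟩ := P_Lap (n + 1) q hq
  replace hr : r ∈ P n := hr
  obtain ⟨r', hr', h'⟩ := P_Lap n r hr
  have cq := (P_smooth _ q hq).1
  have cr := (P_smooth _ r hr).1
  have c' := (P_smooth _ r' (Pm_le n hr')).1
  have e1 : I (fun x => r.1 x * r.1 x) = 1 * I (fun x => r.1 x * Lap q x)
      + ((n + 1) * (n + 2)) * I (fun x => r.1 x * q.1 x) := by
    refine I_lin2 _ _ (cr.continuousOn.mul (cLap cq)) (cr.continuousOn.mul cq.continuousOn) ?_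
    intro x hx
    rw [h x hx]; push_cast; ring
  have e2 : I (fun x => q.1 x * Lap r x) = - (n * (n + 1)) * I (fun x => r.1 x * q.1 x) +
      1 * I (fun x => r'.1 x * q.1 x) := by
    refine I_lin2 _ _ (cr.continuousOn.mul cq.continuousOn) (c'.continuousOn.mul cq.continuousOn) ?_
    intro x hx
    rw [h' x hx]; ring
  rw [ho r hr, ho r' (Pm_le n hr')] at e2
  rw [Green2 cr cq, e2, ho r hr] at e1
  have hz := I_pos_zero (F := fun x => r.1 x * r.1 x) (cr.continuousOn.mul cr.continuousOn)
    (fun x _ => mul_self_nonneg _) (fun c hc x hx => by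
      show r.1 (c • x) * r.1 (c • x) = r.1 x * r.1 x
      rw [(P_smooth _ r hr).2 c hc x hx]) (by rw [e1]; simp)
  intro x hx
  rw [h x hx, mul_self_eq_zero.mp (hz x hx)]
  push_cast; ring

/-! L2 embedding -/
lemma memLp_cut (f : A) : MemLp (fun x => f.1 x * cut x) 2 (volume : Measure V) :=
  (continuous_mul_cut f.2).memLp_of_hasCompactSupport (hcs_mul_cut _)

def T : A →ₗ[ℝ] Lp ℝ 2 (volume : Measure V) where
  toFun f := (memLp_cut f).toLp _
  map_add' f g := by
    rw [← MemLp.toLp_add]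
    congr 1
    funext x
    show (f.1 x + g.1 x) * cut x = f.1 x * cut x + g.1 x * cut x
    ring
  map_smul' c f := by
    simp only [RingHom.id_apply]
    rw [← MemLp.toLp_const_smul]
    congr 1
    funext x
    show (c * f.1 x) * cut x = c * (f.1 x * cut x)
    ring

lemma T_inner (f g : A) : inner ℝ (T f) (T g) = Z0 * I (fun x => f.1 x * g.1 x) := by
  rw [L2.inner_def]
  unfold I
  rw [mul_div_cancel₀ _ Z0_pos.ne']
  apply integral_congr_ae
  filter_upwards [(memLp_cut f).coeFn_toLp, (memLp_cut g).coeFn_toLp] with x h1 h2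
  have e1 : (T f : V → ℝ) x = f.1 x * cut x := h1
  have e2 : (T g : V → ℝ) x = g.1 x * cut x := h2
  rw [e1, e2]
  simp [rho]
  ring

lemma P_dense {d : V → ℝ} (hd : ContinuousOn d Om) (hh : Hom d) {ε : ℝ} (hε : 0 < ε) :
    ∃ n, ∃ p ∈ P n, ∀ x ∈ Om, |d x - p.1 x| < ε := by
  have hcl : IsClosed sphere3 := by
    have : Continuous (fun x : V => x 0 ^ 2 + x 1 ^ 2 + x 2 ^ 2) := by fun_prop
    exact isClosed_singleton.preimage this
  have hbd : Bornology.IsBounded sphere3 := by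
    refine (Metric.isBounded_closedBall (x := (0:V)) (r := 2)).subset ?_
    intro x hx
    rw [mem_closedBall_zero_iff, pi_norm_le_iff_of_nonneg (by norm_num)]
    have h3 : x 0 ^ 2 + x 1 ^ 2 + x 2 ^ 2 = 1 := hx
    intro i
    rw [Real.norm_eq_abs, abs_le]
    fin_cases i <;> simp <;>
      constructor <;> nlinarith [sq_nonneg (x 0), sq_nonneg (x 1), sq_nonneg (x 2)]
  have : CompactSpace sphere3 := isCompact_iff_compactSpace.mp (Metric.isCompact_of_isClosed_isBounded hcl hbd)
  let res (f : A) : C(sphere3, ℝ) := ⟨fun x => f.1 x.1,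
    continuousOn_iff_continuous_domRestrict.mp (f.2.mono fun x hx => sphere_Om hx)⟩
  let S : Subalgebra ℝ C(sphere3, ℝ) :=
    { carrier := {f | ∃ n, ∃ p ∈ P n, f = res p}
      mul_mem' := by
        rintro _ _ ⟨n, p, hp, rfl⟩ ⟨m, q, hq, rfl⟩
        exact ⟨n + m, p * q, P_mul hq n p hp, rfl⟩
      add_mem' := by
        rintro _ _ ⟨n, p, hp, rfl⟩ ⟨m, q, hq, rfl⟩
        exact ⟨n + m, p + q, (P (n + m)).add_mem (P_mono (by omega) hp) (P_mono (by omega) hq), rfl⟩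
      algebraMap_mem' := by
        intro c
        refine ⟨0, c • 1, (P 0).smul_mem c one_mem_P, ?_⟩
        ext x
        simp [res] }
  have hS : S.SeparatesPoints := by
    intro x y hxy
    by_contra hcon
    push Not at hcon
    apply hxy
    apply Subtype.ext
    have hxi (i : Fin 3) : xi i x.1 = xi i y.1 := by
      refine hcon (fun z => xi i z.1) ⟨res (xiA i * 1), ⟨1, xiA i * 1, xi_mul_mem i one_mem_P, rfl⟩, ?_⟩
      funext z
      show xi i z.1 * 1 = _
      ring
    rw [← xi_of_sphere x.2, ← xi_of_sphere y.2]
    funext i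
    exact hxi i
  obtain ⟨⟨g, n, p, hp, rfl⟩, hg⟩ :=
    ContinuousMap.exists_mem_subalgebra_near_continuousMap_of_separatesPoints S hS (res ⟨d, hd⟩) ε hε
  refine ⟨n, p, hp, fun x hx => ?_⟩
  have h1 := ((res p - res ⟨d, hd⟩).norm_coe_le_norm ⟨_, xi_mem_sphere hx⟩).trans_lt hg
  have hx2 : (fun k => xi k x) = (rr x)⁻¹ • x := by funext k; simp [xi]; ring
  have h2 : (res p - res ⟨d, hd⟩) ⟨_, xi_mem_sphere hx⟩ = p.1 (fun k => xi k x) - d (fun k => xi k x) := rfl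
  have hr := inv_pos.mpr (rr_pos hx)
  rw [h2, hx2, (P_smooth n p hp).2 _ hr x hx, hh _ hr x hx, Real.norm_eq_abs, abs_sub_comm] at h1
  exact h1

lemma hilbert {H : Type*} [NormedAddCommGroup H] [InnerProductSpace ℝ H] (Q : ℕ → Submodule ℝ H)
    [∀ n, FiniteDimensional ℝ (Q n)] (hm : Monotone Q) (d δ : H) (k : ℕ)
    (he : ∀ n, ∀ q ∈ Q (n + 1), (∀ p ∈ Q n, inner ℝ p q = 0) →
      inner ℝ δ q = - (((n:ℝ) + 1) * (n + 2)) * inner ℝ d q)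
    (hk : ∀ p ∈ Q k, inner ℝ d p = 0)
    (hd : ∀ ε > 0, ∃ n, ∃ p ∈ Q n, ‖d - p‖ < ε) :
    inner ℝ δ d ≤ - (((k:ℝ) + 1) * (k + 2)) * inner ℝ d d := by
  have hpe : ∀ n, (Q n).starProjection d ∈ Q n := fun n => (Q n).starProjection_apply_mem d
  have hpo : ∀ n, ∀ q ∈ Q n, inner ℝ (d - (Q n).starProjection d) q = 0 := fun n q hq =>
    (Q n).starProjection_inner_eq_zero d q hq
  have step : ∀ N, inner ℝ δ ((Q (k + N)).starProjection d) ≤ - (((k:ℝ) + 1) * (k + 2)) *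
      inner ℝ ((Q (k + N)).starProjection d) ((Q (k + N)).starProjection d) := by
    intro N
    induction N with
    | zero =>
      have : (Q (k + 0)).starProjection d = 0 := by
        have h1 := hpo k _ (hpe k)
        rw [inner_sub_left, hk _ (hpe k), zero_sub, neg_eq_zero, inner_self_eq_zero] at h1
        exact h1
      rw [this]; simp
    | succ N ih =>
      set p := (Q (k + N)).starProjection d with hp
      set p' := (Q (k + (N + 1))).starProjection d with hp'
      set e := p' - p with hee
      have hle : Q (k + N) ≤ Q (k + N + 1) := hm (by omega)
      have heQ : e ∈ Q (k + N + 1) := (Q (k + N + 1)).sub_mem (hpe (k + N + 1)) (hle (hpe (k + N)))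
      have heo : ∀ q ∈ Q (k + N), inner ℝ q e = 0 := by
        intro q hq
        have h1 := hpo (k + N) q hq
        have h2 := hpo (k + N + 1) q (hle hq)
        rw [real_inner_comm]
        have : e = (d - p) - (d - p') := by rw [hee]; abel
        rw [this, inner_sub_left, h1]
        rw [show (Q (k + N + 1)).starProjection d = p' from rfl] at h2
        rw [h2, sub_zero]
      have h3 := he (k + N) e heQ heo
      have h4 : inner ℝ d e = inner ℝ e e := by
        have h5 := hpo (k + N + 1) e heQ
        rw [show (Q (k + N + 1)).starProjection d = p' from rfl] at h5
        have h6 := heo p (hpe (k + N))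
        have : d = (d - p') + e + p := by rw [hee]; abel
        rw [this, inner_add_left, inner_add_left, h5, h6]; ring
      have h7 : inner ℝ p' p' = inner ℝ p p + inner ℝ e e := by
        have : p' = p + e := by rw [hee]; abel
        have h6 := heo p (hpe (k + N))
        rw [this, inner_add_left, inner_add_right, inner_add_right, real_inner_comm p e, h6]
        ring
      have h8 : inner ℝ δ p' = inner ℝ δ p + inner ℝ δ e := by
        rw [← inner_add_right]; congr 1; rw [hee]; abel
      rw [h8, h7, h3, h4]
      have h9 : 0 ≤ inner ℝ e e := real_inner_self_nonneg
      push_cast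
      have h10 : ((k:ℝ) + 1) * (k + 2) ≤ ((k + N : ℝ) + 1) * ((k + N : ℝ) + 2) := by
        have : (0:ℝ) ≤ N := Nat.cast_nonneg N
        gcongr <;> linarith
      nlinarith [mul_le_mul_of_nonneg_right h10 h9]
  have hlim : Filter.Tendsto (fun N => (Q (k + N)).starProjection d) Filter.atTop (nhds d) := by
    rw [Metric.tendsto_atTop]
    intro ε hε
    obtain ⟨n, p, hp, hlt⟩ := hd ε hε
    refine ⟨n, fun N hN => ?_⟩
    have hpQ : p ∈ Q (k + N) := hm (by omega) hp
    rw [dist_comm, dist_eq_norm]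
    refine lt_of_le_of_lt ?_ hlt
    rw [Submodule.starProjection_minimal]
    exact ciInf_le ⟨0, by rintro _ ⟨y, rfl⟩; exact norm_nonneg _⟩ (⟨p, hpQ⟩ : Q (k + N))
  have l1 : Filter.Tendsto (fun N => inner ℝ δ ((Q (k + N)).starProjection d)) Filter.atTop
      (nhds (inner ℝ δ d)) := (tendsto_const_nhds).inner hlim
  have l2 : Filter.Tendsto (fun N => - (((k:ℝ) + 1) * (k + 2)) *
      inner ℝ ((Q (k + N)).starProjection d) ((Q (k + N)).starProjection d)) Filter.atTop
      (nhds (- (((k:ℝ) + 1) * (k + 2)) * inner ℝ d d)) := (hlim.inner hlim).const_mul _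
  exact le_of_tendsto_of_tendsto' l1 l2 step

lemma poinc {d : V → ℝ} (hd : ContDiffOn ℝ 2 d Om) (hh : Hom d) (k : ℕ)
    (ho : ∀ p ∈ P k, I (fun x => d x * p.1 x) = 0) :
    (((k:ℝ) + 1) * (k + 2)) * I (fun x => d x * d x) ≤ - I (fun x => d x * Lap d x) := by
  let dA : A := ⟨d, hd.continuousOn⟩
  let lA : A := ⟨Lap d, cLap hd⟩
  have : ∀ n, FiniteDimensional ℝ ((P n).map T) := by
    intro n
    have := P_fin n
    infer_instance
  have key := hilbert (fun n => (P n).map T) (fun n m h => Submodule.map_mono (P_mono h)) (T dA) (T lA) k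
    ?_ ?_ ?_
  · rw [T_inner, T_inner] at key
    have e : I (fun x => lA.1 x * dA.1 x) = I (fun x => d x * Lap d x) := I_congr fun x _ => mul_comm _ _
    rw [e] at key
    have e2 : I (fun x => dA.1 x * dA.1 x) = I (fun x => d x * d x) := rfl
    rw [e2] at key
    have hz := Z0_pos
    by_contra hcon
    push Not at hcon
    nlinarith
  · rintro n _ ⟨q, hq, rfl⟩ ho
    have hE := P_eigen hq (fun p hp => by
      have := ho (T p) ⟨p, hp, rfl⟩
      rw [T_inner] at this
      exact (mul_eq_zero.mp this).resolve_left Z0_pos.ne')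
    rw [T_inner, T_inner]
    have cq := (P_smooth _ q hq).1
    have e1 : I (fun x => lA.1 x * q.1 x) = I (fun x => d x * Lap q x) := by
      rw [Green2 hd cq]
      exact I_congr fun x _ => mul_comm _ _
    rw [e1, I_lin1 (- (((n:ℝ) + 1) * (n + 2))) (f := fun x => dA.1 x * q.1 x)]
    · ring
    · intro x hx
      rw [hE x hx]
      show d x * _ = _ * (d x * _)
      ring
  · rintro _ ⟨p, hp, rfl⟩
    rw [T_inner]
    have := ho p hp
    show Z0 * I (fun x => d x * p.1 x) = 0
    rw [this, mul_zero]
  · intro ε hε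
    obtain ⟨n, p, hp, hlt⟩ := P_dense hd.continuousOn hh (ε := ε / (2 * Real.sqrt Z0))
      (div_pos hε (mul_pos two_pos (Real.sqrt_pos.mpr Z0_pos)))
    refine ⟨n, T p, ⟨p, hp, rfl⟩, ?_⟩
    rw [← map_sub]
    have hsq : ‖T (dA - p)‖ ^ 2 ≤ (ε / 2) ^ 2 := by
      rw [← real_inner_self_eq_norm_sq, T_inner]
      set η := ε / (2 * Real.sqrt Z0) with hη
      have h1 : I (fun x => (dA - p).1 x * (dA - p).1 x) ≤ I (fun _ => η ^ 2) := by
        refine I_mono ((dA - p).2.mul (dA - p).2) continuousOn_const fun x hx => ?_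
        have h2 := hlt x hx
        show (d x - p.1 x) * (d x - p.1 x) ≤ _
        rw [← sq, ← sq_abs]
        exact pow_le_pow_left₀ (abs_nonneg _) h2.le 2
      have h3 : I (fun _ => η ^ 2) = η ^ 2 := by
        rw [I_lin1 (η ^ 2) (f := fun _ => 1) (fun x _ => by ring), I_one, mul_one]
      rw [h3] at h1
      have h4 : η ^ 2 * Z0 = (ε / 2) ^ 2 := by
        rw [hη, div_pow, mul_pow, Real.sq_sqrt Z0_pos.le]
        have := Z0_pos.ne'
        field_simp
      nlinarith [Z0_pos]
    have := abs_le_of_sq_le_sq hsq (by positivity)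
    rw [abs_of_nonneg (norm_nonneg _)] at this
    linarith

end MF

namespace MF

def Hs (φ g : V → ℝ) (x : V) : ℝ :=
  X 0 g x * (X 0 (X 0 φ) x * X 0 g x + X 0 (X 1 φ) x * X 1 g x + X 0 (X 2 φ) x * X 2 g x)
  + X 1 g x * (X 1 (X 0 φ) x * X 0 g x + X 1 (X 1 φ) x * X 1 g x + X 1 (X 2 φ) x * X 2 g x)
  + X 2 g x * (X 2 (X 0 φ) x * X 0 g x + X 2 (X 1 φ) x * X 1 g x + X 2 (X 2 φ) x * X 2 g x)

lemma X_Grad (j : Fin 3) {f g : V → ℝ} {x : V} (hf : ContDiffAt ℝ 2 f x) (hg : ContDiffAt ℝ 2 g x) :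
    X j (Grad f g) x = (X 0 f x * X j (X 0 g) x + X j (X 0 f) x * X 0 g x)
     + (X 1 f x * X j (X 1 g) x + X j (X 1 f) x * X 1 g x)
     + (X 2 f x * X j (X 2 g) x + X j (X 2 f) x * X 2 g x) := by
  have e : Grad f g = fun y => X 0 f y * X 0 g y + X 1 f y * X 1 g y + X 2 f y * X 2 g y := rfl
  have d (i : Fin 3) : DifferentiableAt ℝ (fun y => X i f y * X i g y) x := (daX i hf).mul (daX i hg)
  rw [e, X_add j (f := fun y => X 0 f y * X 0 g y + X 1 f y * X 1 g y) (g := fun y => X 2 f y * X 2 g y)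
      ((d 0).add (d 1)) (d 2), X_add j (f := fun y => X 0 f y * X 0 g y) (g := fun y => X 1 f y * X 1 g y) (d 0) (d 1), X_mul j (daX 0 hf) (daX 0 hg),
    X_mul j (daX 1 hf) (daX 1 hg), X_mul j (daX 2 hf) (daX 2 hg)]

lemma cHs {φ g : V → ℝ} (hφ : ContDiffOn ℝ 2 φ Om) (hg : ContDiffOn ℝ 2 g Om) :
    ContinuousOn (Hs φ g) Om := by
  have h (i j : Fin 3) : ContinuousOn (X i (X j φ)) Om := c1X i (c2X j hφ)
  have k (i : Fin 3) : ContinuousOn (X i g) Om := c1X i (c2c1 hg)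
  have := h 0 0
  have := h 0 1
  have := h 0 2
  have := h 1 0
  have := h 1 1
  have := h 1 2
  have := h 2 0
  have := h 2 1
  have := h 2 2
  have := k 0
  have := k 1
  have := k 2
  unfold Hs
  fun_prop

lemma Bochner {φ g : V → ℝ} (hφ : ContDiffOn ℝ 2 φ Om) (hg : ContDiffOn ℝ 2 g Om) :
    I (fun x => Lap g x * Grad φ g x) = - I (Hs φ g) + 1 / 2 * I (fun x => Lap φ x * Grad g g x) := by
  have key : I (fun x => Lap g x * Grad φ g x + Hs φ g x - 1 / 2 * (Lap φ x * Grad g g x)) = 0 := by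
    have hc (j : Fin 3) : ContDiffOn ℝ 1
        (fun x => X j g x * Grad φ g x + (-1/2) * (X j φ x * Grad g g x)) Om :=
      ((c2X j hg).mul (c1Grad hφ hg)).add (contDiffOn_const.mul ((c2X j hφ).mul (c1Grad hg hg)))
    refine I_div (hc 0) (hc 1) (hc 2) fun x hx => ?_
    have cφ := cdat hφ hx
    have cg := cdat hg hx
    have dG : DifferentiableAt ℝ (Grad φ g) x := diffAt one_ne_zero (c1Grad hφ hg) hx
    have dG2 : DifferentiableAt ℝ (Grad g g) x := diffAt one_ne_zero (c1Grad hg hg) hx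
    have e (j : Fin 3) : X j (fun x => X j g x * Grad φ g x + (-1/2) * (X j φ x * Grad g g x)) x
        = (X j g x * X j (Grad φ g) x + X j (X j g) x * Grad φ g x)
         + (-1/2) * (X j φ x * X j (Grad g g) x + X j (X j φ) x * Grad g g x) := by
      have d1 : DifferentiableAt ℝ (fun x => X j g x * Grad φ g x) x := (daX j cg).mul dG
      have d2 : DifferentiableAt ℝ (fun x => X j φ x * Grad g g x) x := (daX j cφ).mul dG2
      rw [X_add j (f := fun x => X j g x * Grad φ g x) (g := fun x => (-1/2) * (X j φ x * Grad g g x))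
        d1 (d2.const_mul _), X_smul j _ d2, X_mul j (daX j cg) dG, X_mul j (daX j cφ) dG2]
    rw [e 0, e 1, e 2, X_Grad 0 cφ cg, X_Grad 1 cφ cg, X_Grad 2 cφ cg,
      X_Grad 0 cg cg, X_Grad 1 cg cg, X_Grad 2 cg cg]
    rw [comm01 cg, comm12 cg, comm20 cg]
    unfold Lap Hs Grad
    ring
  have c1 : ContinuousOn (fun x => Lap g x * Grad φ g x) Om := (cLap hg).mul (cGrad (c2c1 hφ) (c2c1 hg))
  have c2 : ContinuousOn (fun x => Lap φ x * Grad g g x) Om := (cLap hφ).mul (cGrad (c2c1 hg) (c2c1 hg))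
  rw [I_lin3 1 1 (-1/2) c1 (cHs hφ hg) c2 (fun x _ => by ring)] at key
  linarith

lemma Hs_mul {a b g : V → ℝ} {x : V} (ha : ContDiffAt ℝ 2 a x) (hb : ContDiffAt ℝ 2 b x) :
    Hs (fun y => a y * b y) g x = a x * Hs b g x + Hs a g x * b x + 2 * Grad a g x * Grad b g x := by
  unfold Hs Grad
  simp only [XX_mul _ _ ha hb]
  ring

lemma Hs_add {a b g : V → ℝ} {x : V} (ha : ContDiffAt ℝ 2 a x) (hb : ContDiffAt ℝ 2 b x) :
    Hs (fun y => a y + b y) g x = Hs a g x + Hs b g x := by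
  unfold Hs
  simp only [XX_add _ _ ha hb]
  ring

lemma Hs_smul (c : ℝ) {a g : V → ℝ} {x : V} (ha : ContDiffAt ℝ 2 a x) :
    Hs (fun y => c * a y) g x = c * Hs a g x := by
  unfold Hs
  simp only [XX_smul _ _ c ha]
  ring

lemma Hs_xi (k : Fin 3) (g : V → ℝ) {x : V} (hx : x ∈ Om) :
    Hs (xi k) g x = - xi k x * Grad g g x := by
  have hp := xi_perp g x
  unfold Hs Grad
  simp only [XX_xi _ _ _ hx]
  fin_cases k <;> simp [rot]
  · linear_combination X 0 g x * hp
  · linear_combination X 1 g x * hp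
  · linear_combination X 2 g x * hp

/-- gradient in coordinates -/
lemma Grad_coord (f g : V → ℝ) {x : V} (hx : x ∈ Om) :
    Grad f g x = Grad (xi 0) f x * Grad (xi 0) g x + Grad (xi 1) f x * Grad (xi 1) g x
      + Grad (xi 2) f x * Grad (xi 2) g x := by
  have hp := xi_perp f x
  have hs := xi_sq hx
  unfold Grad
  simp only [X_xi _ _ hx]
  simp [rot]
  linear_combination (-(X 0 f x * X 0 g x + X 1 f x * X 1 g x + X 2 f x * X 2 g x)) * hs
    + (xi 0 x * X 0 g x + xi 1 x * X 1 g x + xi 2 x * X 2 g x) * hp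

lemma Grad_coord_perp (f : V → ℝ) {x : V} (hx : x ∈ Om) :
    xi 0 x * Grad (xi 0) f x + xi 1 x * Grad (xi 1) f x + xi 2 x * Grad (xi 2) f x = 0 := by
  unfold Grad
  simp only [X_xi _ _ hx]
  simp [rot]
  ring

/-! finite sums -/
abbrev Mt := Fin 3 → Fin 3 → ℝ

def Q (M : Mt) (x : V) : ℝ := ∑ a, ∑ b, M a b * (xi a x * xi b x)

lemma cQ (M : Mt) {n : WithTop ℕ∞} : ContDiffOn ℝ n (Q M) Om := by
  unfold Q
  refine ContDiffOn.sum fun a _ => ContDiffOn.sum fun b _ => ?_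
  exact contDiffOn_const.mul ((cd_xi a).mul (cd_xi b))

/-- an operator that is additive on functions twice differentiable at `x` -/
lemma op_Q (Op : (V → ℝ) → ℝ) {x : V} (hx : x ∈ Om)
    (hadd : ∀ f g, ContDiffAt ℝ 2 f x → ContDiffAt ℝ 2 g x → Op (fun y => f y + g y) = Op f + Op g)
    (hsm : ∀ c f, ContDiffAt ℝ 2 f x → Op (fun y => c * f y) = c * Op f) (M : Mt) :
    Op (Q M) = ∑ a, ∑ b, M a b * Op (fun y => xi a y * xi b y) := by
  have hq (a b : Fin 3) : ContDiffAt ℝ 2 (fun y => xi a y * xi b y) x :=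
    (cdat (cd_xi a) hx).mul (cdat (cd_xi b) hx)
  have hm (a b : Fin 3) : ContDiffAt ℝ 2 (fun y => M a b * (xi a y * xi b y)) x :=
    contDiffAt_const.mul (hq a b)
  have e : Q M = fun y => (fun y => (fun y => (fun y => (fun y => (fun y => M 0 0 * (xi 0 y * xi 0 y)) y
      + (fun y => M 0 1 * (xi 0 y * xi 1 y)) y) y + (fun y => M 0 2 * (xi 0 y * xi 2 y)) y) y +
      (fun y => (fun y => (fun y => M 1 0 * (xi 1 y * xi 0 y)) y
      + (fun y => M 1 1 * (xi 1 y * xi 1 y)) y) y + (fun y => M 1 2 * (xi 1 y * xi 2 y)) y) y) y) y +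
      (fun y => (fun y => (fun y => M 2 0 * (xi 2 y * xi 0 y)) y
      + (fun y => M 2 1 * (xi 2 y * xi 1 y)) y) y + (fun y => M 2 2 * (xi 2 y * xi 2 y)) y) y := by
    funext y
    simp only [Q, Fin.sum_univ_three]
  rw [e, hadd _ _ ((((hm _ _).add (hm _ _)).add (hm _ _)).add (((hm _ _).add (hm _ _)).add (hm _ _)))
    (((hm _ _).add (hm _ _)).add (hm _ _)),
    hadd _ _ (((hm _ _).add (hm _ _)).add (hm _ _)) (((hm _ _).add (hm _ _)).add (hm _ _)),
    hadd _ _ ((hm _ _).add (hm _ _)) (hm _ _), hadd _ _ ((hm _ _).add (hm _ _)) (hm _ _),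
    hadd _ _ ((hm _ _).add (hm _ _)) (hm _ _), hadd _ _ (hm _ _) (hm _ _), hadd _ _ (hm _ _) (hm _ _),
    hadd _ _ (hm _ _) (hm _ _)]
  simp only [Fin.sum_univ_three, hsm _ _ (hq _ _)]

lemma Lap_xixi (a b : Fin 3) {x : V} (hx : x ∈ Om) :
    Lap (fun y => xi a y * xi b y) x = 2 * dl a b - 6 * (xi a x * xi b x) := by
  rw [Lap_mul (cdat (cd_xi a) hx) (cdat (cd_xi b) hx), Lap_xi _ hx, Lap_xi _ hx, Grad_xi _ _ hx]
  ring

lemma Lap_Q (M : Mt) {x : V} (hx : x ∈ Om) :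
    Lap (Q M) x = 2 * (M 0 0 + M 1 1 + M 2 2) - 6 * Q M x := by
  rw [op_Q (fun f => Lap f x) hx (fun f g hf hg => Lap_add hf hg) (fun c f hf => Lap_smul c hf) M]
  simp only [Lap_xixi _ _ hx, Q, Fin.sum_univ_three, dl]
  simp
  ring

lemma Grad_Q (M : Mt) (f : V → ℝ) {x : V} (hx : x ∈ Om) :
    Grad f (Q M) x = ∑ a, ∑ b, M a b * (xi a x * Grad (xi b) f x + Grad (xi a) f x * xi b x) := by
  rw [op_Q (fun g => Grad f g x) hx (fun f g hf hg => Grad_add (da hf) (da hg))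
    (fun c f hf => Grad_smul c (da hf)) M]
  have (a b : Fin 3) : Grad f (fun y => xi a y * xi b y) x
      = xi a x * Grad (xi b) f x + Grad (xi a) f x * xi b x := by
    rw [Grad_mul (da (cdat (cd_xi a) hx)) (da (cdat (cd_xi b) hx)), Grad_comm f, Grad_comm f]
  simp only [this]

lemma Hs_Q (M : Mt) (g : V → ℝ) {x : V} (hx : x ∈ Om) :
    Hs (Q M) g x = - 2 * Q M x * Grad g g x +
      2 * ∑ a, ∑ b, M a b * (Grad (xi a) g x * Grad (xi b) g x) := by
  rw [op_Q (fun f => Hs f g x) hx (fun f g hf hg => Hs_add hf hg) (fun c f hf => Hs_smul c hf) M]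
  have (a b : Fin 3) : Hs (fun y => xi a y * xi b y) g x
      = -2 * (xi a x * xi b x) * Grad g g x + 2 * (Grad (xi a) g x * Grad (xi b) g x) := by
    rw [Hs_mul (cdat (cd_xi a) hx) (cdat (cd_xi b) hx), Hs_xi _ _ hx, Hs_xi _ _ hx]
    ring
  simp only [this, Q, Fin.sum_univ_three]
  ring

def mm (M N : Mt) : Mt := fun a b => ∑ c, M a c * N c b

def Sym (M : Mt) : Prop := ∀ a b, M a b = M b a

lemma Grad_QQ {M N : Mt} (hM : Sym M) (hN : Sym N) {x : V} (hx : x ∈ Om) :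
    Grad (Q N) (Q M) x = 4 * Q (mm N M) x - 4 * (Q N x * Q M x) := by
  have hR (a : Fin 3) : Grad (xi a) (Q N) x = ∑ c, 2 * N a c * xi c x - 2 * xi a x * Q N x := by
    rw [Grad_Q N _ hx]
    simp only [Grad_xi _ _ hx, Q, Fin.sum_univ_three]
    rw [hN 1 0, hN 2 0, hN 2 1]
    fin_cases a <;> simp [dl] <;> first | ring1 | (rw [hN 1 0]; ring1) | (rw [hN 2 0, hN 2 1]; ring1)
  rw [Grad_Q M _ hx]
  simp only [hR]
  generalize hq : Q N x = q
  simp only [Q, mm, Fin.sum_univ_three]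
  rw [hM 1 0, hM 2 0, hM 2 1, hN 1 0, hN 2 0, hN 2 1]
  ring

end MF

namespace MF

lemma neg_Om {x : V} (hx : x ∈ Om) : -x ∈ Om := neg_ne_zero.mpr hx

lemma I_odd {f : V → ℝ} (h : ∀ x ∈ Om, f (-x) = - f x) : I f = 0 := by
  have h1 := I_neg f
  have h2 := I_lin1 (-1) (F := fun x => f (-x)) (f := f) (fun x hx => by rw [h x hx]; ring)
  linarith

lemma rot_neg (i : Fin 3) (x : V) : rot i (-x) = - rot i x := by
  funext j
  fin_cases i <;> fin_cases j <;> simp [rot]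

lemma X_negc (i : Fin 3) (f : V → ℝ) : X i (fun y => f (-y)) = fun x => X i f (-x) := by
  funext x
  have h := fderiv_comp_smul (𝕜 := ℝ) (f := f) (x := x) (-1)
  simp only [neg_smul, one_smul] at h
  unfold X
  rw [h, rot_neg]
  simp

lemma Lap_negc (f : V → ℝ) (x : V) : Lap (fun y => f (-y)) x = Lap f (-x) := by
  unfold Lap
  simp only [X_negc]

lemma negc_c2 {f : V → ℝ} (hf : ContDiffOn ℝ 2 f Om) : ContDiffOn ℝ 2 (fun y => f (-y)) Om :=
  hf.comp contDiff_neg.contDiffOn (fun _ hx => neg_Om hx)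

lemma cxi (k : Fin 3) : ContinuousOn (xi k) Om := (cd_xi k (n := 0)).continuousOn

/-- orthogonality to polynomials of degree at most `n` -/
def Orth (n : ℕ) (f : V → ℝ) : Prop := ∀ p ∈ P n, I (fun x => f x * p.1 x) = 0

def Lf (f : V → ℝ) (hf : ContinuousOn f Om) : A →ₗ[ℝ] ℝ where
  toFun p := I (fun x => f x * p.1 x)
  map_add' p q := by
    have cp : ContinuousOn p.1 Om := p.2
    have cq : ContinuousOn q.1 Om := q.2
    rw [I_lin2 1 1 (f := fun x => f x * p.1 x) (g := fun x => f x * q.1 x) (hf.mul cp) (hf.mul cq) (fun x _ => ?_)]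
    · simp
    · simp; ring
  map_smul' c p := by
    rw [I_lin1 c (f := fun x => f x * p.1 x) (fun x _ => ?_)]
    · simp
    · simp; ring

lemma orth_zero {f : V → ℝ} (hf : ContinuousOn f Om) (h : I f = 0) : Orth 0 f := by
  have : P 0 ≤ LinearMap.ker (Lf f hf) := by
    unfold P
    rw [Submodule.span_le, Set.singleton_subset_iff]
    show Lf f hf 1 = 0
    simpa [Lf] using h
  exact fun p hp => this hp

lemma orth_succ {n : ℕ} {f : V → ℝ} (hf : ContinuousOn f Om) (h0 : Orth n f)
    (h : ∀ k, Orth n (fun x => f x * xi k x)) : Orth (n + 1) f := by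
  have hk (k : Fin 3) : (P n).map (LinearMap.mulLeft ℝ (xiA k)) ≤ LinearMap.ker (Lf f hf) := by
    rintro _ ⟨p, hp, rfl⟩
    have := h k p hp
    show I _ = 0
    rw [← this]
    apply I_congr
    intro x _
    show f x * (xi k x * p.1 x) = _
    ring
  have : P (n + 1) ≤ LinearMap.ker (Lf f hf) := by
    rw [P]
    exact sup_le (fun p hp => h0 p hp) (sup_le (hk 0) (sup_le (hk 1) (hk 2)))
  exact fun p hp => this hp

lemma I_Lap {g : V → ℝ} (hg : ContDiffOn ℝ 2 g Om) : I (Lap g) = 0 := by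
  have h := Green (f := fun _ => 1) contDiffOn_const hg
  rw [I_congr (f := Grad (fun _ => 1) g) (g := fun _ => 0)
    (fun x _ => by rw [Grad_comm, Grad_const]), I_zero] at h
  simpa using h

lemma I_Q (M : Mt) : I (Q M) = (M 0 0 + M 1 1 + M 2 2) / 3 := by
  have h := I_Lap (cQ M (n := 2))
  rw [I_lin2 (2 * (M 0 0 + M 1 1 + M 2 2)) (-6) (f := fun _ => 1) (g := Q M) continuousOn_const
    (cQ M (n := 0)).continuousOn (fun x hx => by rw [Lap_Q M hx]; ring), I_one] at h
  linarith

lemma Lap_QQ {M N : Mt} (hM : Sym M) (hN : Sym N) {x : V} (hx : x ∈ Om) :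
    Lap (fun y => Q N y * Q M y) x = 8 * Q (mm N M) x - 20 * (Q N x * Q M x)
      + 2 * (M 0 0 + M 1 1 + M 2 2) * Q N x + 2 * (N 0 0 + N 1 1 + N 2 2) * Q M x := by
  rw [Lap_mul (cdat (cQ N) hx) (cdat (cQ M) hx), Lap_Q M hx, Lap_Q N hx, Grad_QQ hM hN hx]
  ring

def tr (M : Mt) : ℝ := M 0 0 + M 1 1 + M 2 2

lemma conQ (M : Mt) : ContinuousOn (Q M) Om := (cQ M (n := 0)).continuousOn

lemma I_QQ {M N : Mt} (hM : Sym M) (hN : Sym N) :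
    I (fun x => Q N x * Q M x) = (tr M * tr N + 2 * tr (mm N M)) / 15 := by
  have h := I_Lap (g := fun y => Q N y * Q M y) ((cQ N (n := 2)).mul (cQ M))
  rw [I_lin4 8 (-20) (2 * tr M) (2 * tr N) (f := Q (mm N M)) (g := fun x => Q N x * Q M x)
    (k := Q N) (l := Q M) (conQ _) ((conQ _).mul (conQ _)) (conQ _) (conQ _)
    (fun x hx => by rw [Lap_QQ hM hN hx]; unfold tr; ring), I_Q, I_Q, I_Q] at h
  unfold tr at *
  linarith

/-- symmetric elementary matrix -/
def El (k l : Fin 3) : Mt := fun a b => (dl a k * dl b l + dl a l * dl b k) / 2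

lemma El_sym (k l : Fin 3) : Sym (El k l) := by
  intro a b
  unfold El
  ring

lemma Q_El (k l : Fin 3) (x : V) : Q (El k l) x = xi k x * xi l x := by
  unfold Q El
  fin_cases k <;> fin_cases l <;> simp [Fin.sum_univ_three, dl] <;> ring

lemma tr_El (k l : Fin 3) : tr (El k l) = dl k l := by
  unfold tr El
  fin_cases k <;> fin_cases l <;> simp [dl]

lemma tr_mm_El {M : Mt} (hM : Sym M) (k l : Fin 3) : tr (mm M (El k l)) = M k l := by
  have h1 := hM 1 0
  have h2 := hM 2 0
  have h3 := hM 2 1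
  unfold tr mm El
  fin_cases k <;> fin_cases l <;> simp [dl, Fin.sum_univ_three] <;> linarith

lemma I_xixi (k l : Fin 3) : I (fun x => xi k x * xi l x) = dl k l / 3 := by
  have := I_Q (El k l)
  rw [I_congr (fun x _ => Q_El k l x)] at this
  rw [this]
  congr 1
  exact tr_El k l

lemma I_Qxixi {M : Mt} (hM : Sym M) (ht : tr M = 0) (k l : Fin 3) :
    I (fun x => Q M x * (xi k x * xi l x)) = 2 / 15 * M k l := by
  have := I_QQ (El_sym k l) hM
  rw [tr_mm_El hM, ht] at this
  rw [← I_congr (f := fun x => Q M x * Q (El k l) x) (fun x _ => by rw [Q_El]), this]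
  ring

lemma I_xi (k : Fin 3) : I (xi k) = 0 := I_odd fun x _ => xi_neg k x

structure Sol (u : V → ℝ) : Prop where
  c2 : ContDiffOn ℝ 2 u Om
  hom : Hom u
  eq : ∀ x ∈ Om, Lap u x = 6 * (1 - Real.exp (u x))
  bd : ∀ x ∈ Om, Real.exp (u x) ≤ 2

lemma Sol.co {u : V → ℝ} (s : Sol u) : ContinuousOn u Om := s.c2.continuousOn
lemma Sol.ce {u : V → ℝ} (s : Sol u) : ContDiffOn ℝ 2 (fun x => Real.exp (u x)) Om := s.c2.exp
lemma Sol.coe {u : V → ℝ} (s : Sol u) : ContinuousOn (fun x => Real.exp (u x)) Om := s.ce.continuousOn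

lemma Sol.Iw {u : V → ℝ} (s : Sol u) : I (fun x => Real.exp (u x) - 1) = 0 := by
  have h := I_Lap s.c2
  rw [I_lin1 (-6) (f := fun x => Real.exp (u x) - 1) (fun x hx => by rw [s.eq x hx]; ring)] at h
  linarith

lemma Sol.KW {u : V → ℝ} (s : Sol u) (k : Fin 3) :
    I (fun x => (Real.exp (u x) - 1) * xi k x) = 0 ∧ I (fun x => u x * xi k x) = 0 := by
  have c0 := s.co
  have ce := s.coe
  have cx := cxi k
  have h1 := Green2 s.c2 (cd_xi k)
  rw [I_lin1 (-2) (f := fun x => u x * xi k x) (fun x hx => by rw [Lap_xi k hx]; ring),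
    I_lin1 (-6) (F := fun x => xi k x * Lap u x) (f := fun x => (Real.exp (u x) - 1) * xi k x)
      (fun x hx => by rw [s.eq x hx]; ring)] at h1
  have cG : ContinuousOn (Grad u u) Om := cGrad (c2c1 s.c2) (c2c1 s.c2)
  have h2 := Bochner (cd_xi k) s.c2
  rw [I_lin1 (-1) (F := Hs (xi k) u) (f := fun x => xi k x * Grad u u x) (fun x hx => by
    rw [Hs_xi k u hx]; ring),
    I_lin1 (-2) (F := fun x => Lap (xi k) x * Grad u u x) (f := fun x => xi k x * Grad u u x) (fun x hx => by
    rw [Lap_xi k hx]; ring),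
    I_lin1 (-6) (F := fun x => Lap u x * Grad (xi k) u x)
      (f := fun x => (Real.exp (u x) - 1) * Grad (xi k) u x) (fun x hx => by
    rw [s.eq x hx]; ring)] at h2
  have h3 := Green (f := fun x => Real.exp (u x) - u x) (c2c1 (s.ce.sub s.c2)) (cd_xi k)
  rw [I_congr (f := Grad (fun x => Real.exp (u x) - u x) (xi k))
    (g := fun x => (Real.exp (u x) - 1) * Grad (xi k) u x) (fun x hx => by
      rw [Grad_comm, Grad_comp (φ := fun t => Real.exp t - t) (diffAt two_ne_zero s.c2 hx)
        ((Real.hasDerivAt_exp _).sub (hasDerivAt_id _))]),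
    I_lin3 (-2) 2 (-2) (f := fun x => (Real.exp (u x) - 1) * xi k x) (g := fun x => u x * xi k x)
      (k := xi k) (by fun_prop) (by fun_prop) cx (fun x hx => by rw [Lap_xi k hx]; ring), I_xi] at h3
  constructor <;> linarith

lemma D_ineq {a b : ℝ} (ha : Real.exp a ≤ 2) (hb : Real.exp b ≤ 2) :
    0 ≤ 12 * (a - b) ^ 2 - 6 * ((a - b) * (Real.exp a - Real.exp b)) ∧
    (12 * (a - b) ^ 2 - 6 * ((a - b) * (Real.exp a - Real.exp b)) = 0 → a = b) := by
  have key : ∀ a b : ℝ, Real.exp a ≤ 2 → b < a →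
      0 < 12 * (a - b) ^ 2 - 6 * ((a - b) * (Real.exp a - Real.exp b)) := by
    intro a b ha hab
    have h := Real.add_one_lt_exp (x := b - a) (by linarith)
    have e : Real.exp b = Real.exp a * Real.exp (b - a) := by rw [← Real.exp_add]; ring_nf
    have hp := Real.exp_pos a
    have h3 : Real.exp a - Real.exp b < 2 * (a - b) := by
      rw [e]
      nlinarith [mul_lt_mul_of_pos_left h hp, mul_le_mul_of_nonneg_right ha (by linarith : 0 ≤ a - b)]
    nlinarith [mul_lt_mul_of_pos_left h3 (by linarith : 0 < a - b)]
  rcases lt_trichotomy a b with h | h | h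
  · have := key b a hb h
    exact ⟨by nlinarith, fun h0 => by nlinarith⟩
  · subst h; simp
  · have := key a b ha h
    exact ⟨this.le, fun h0 => absurd h0 this.ne'⟩

lemma Sol.even {u : V → ℝ} (s : Sol u) : ∀ x ∈ Om, u (-x) = u x := by
  have c0 := s.co
  have ce := s.coe
  have hn := negc_c2 s.c2
  have c0n : ContinuousOn (fun x => u (-x)) Om := hn.continuousOn
  have cen : ContinuousOn (fun x => Real.exp (u (-x))) Om := hn.exp.continuousOn
  have cd : ContinuousOn (fun x => u x - u (-x)) Om := c0.sub c0n
  have cx := cxi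
  have hh : Hom (fun x => u x - u (-x)) := by
    intro c hc x hx
    show _ - _ = _ - _
    rw [← smul_neg, s.hom c hc x hx, s.hom c hc (-x) (neg_Om hx)]
  have o0 : I (fun x => u x - u (-x)) = 0 := I_odd fun x hx => by simp
  have o1 (k : Fin 3) : I (fun x => (u x - u (-x)) * xi k x) = 0 := by
    have e : I (fun x => u (-x) * xi k x) = - I (fun x => u x * xi k x) := by
      rw [← I_neg (fun x => u x * xi k x), ← neg_one_mul]
      apply I_lin1
      intro x _
      rw [xi_neg]; ring
    have := cx k
    rw [I_lin2 1 (-1) (f := fun x => u x * xi k x) (g := fun x => u (-x) * xi k x) (c0.mul this) (c0n.mul this)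
      (fun x _ => by ring), e, (s.KW k).2]
    ring
  have o2 (k l : Fin 3) : I (fun x => (u x - u (-x)) * xi k x * xi l x) = 0 :=
    I_odd fun x hx => by rw [xi_neg, xi_neg]; simp; ring
  have hO : Orth 2 (fun x => u x - u (-x)) := by
    refine orth_succ cd (orth_succ cd (orth_zero cd o0) fun k => orth_zero (cd.mul (cx k)) (o1 k)) fun k => ?_
    exact orth_succ (cd.mul (cx k)) (orth_zero (cd.mul (cx k)) (o1 k))
      fun l => orth_zero ((cd.mul (cx k)).mul (cx l)) (o2 k l)
  have hp := poinc (s.c2.sub hn) hh 2 hO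
  have hL : ∀ x ∈ Om, Lap (fun x => u x - u (-x)) x = -6 * (Real.exp (u x) - Real.exp (u (-x))) := by
    intro x hx
    have := Lap_add (cdat s.c2 hx) (g := fun y => (-1) * u (-y)) (contDiffAt_const.mul (cdat hn hx))
    rw [Lap_smul (-1) (f := fun y => u (-y)) (cdat hn hx), Lap_negc, s.eq x hx, s.eq _ (neg_Om hx)] at this
    rw [Lap_congr (g := fun y => u y + (-1) * u (-y)) (fun y _ => by ring) hx, this]
    ring
  have hz := I_pos_zero (F := fun x => 12 * (u x - u (-x)) ^ 2
      - 6 * ((u x - u (-x)) * (Real.exp (u x) - Real.exp (u (-x))))) (by fun_prop)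
    (fun x hx => (D_ineq (s.bd x hx) (s.bd _ (neg_Om hx))).1)
    (by
      intro c hc x hx
      beta_reduce
      rw [← smul_neg, s.hom c hc x hx, s.hom c hc (-x) (neg_Om hx)])
    (by
      rw [I_lin2 12 1 (f := fun x => (u x - u (-x)) * (u x - u (-x)))
        (g := fun x => (u x - u (-x)) * Lap (fun x => u x - u (-x)) x) (cd.mul cd)
        (cd.mul (cLap (s.c2.sub hn))) (fun x hx => by rw [hL x hx]; ring)]
      norm_num at hp
      linarith)
  intro x hx
  exact ((D_ineq (s.bd x hx) (s.bd _ (neg_Om hx))).2 (hz x hx)).symm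

end MF

namespace MF

lemma I_mulQ {f : V → ℝ} (hf : ContinuousOn f Om) (K : Mt) :
    I (fun x => f x * Q K x) = ∑ a, ∑ b, K a b * I (fun x => f x * (xi a x * xi b x)) := by
  have h : Lf f hf (∑ a, ∑ b, K a b • (xiA a * xiA b)) =
      ∑ a, ∑ b, K a b * I (fun x => f x * (xi a x * xi b x)) := by
    simp only [map_sum, map_smul]
    rfl
  rw [← h]
  show _ = I _
  apply I_congr
  intro x _
  simp [Q, Fin.sum_univ_three, xiA]

lemma orth3_even {f : V → ℝ} (hf : ContinuousOn f Om) (he : ∀ x ∈ Om, f (-x) = f x)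
    (h0 : I f = 0) (h2 : ∀ k l, I (fun x => f x * (xi k x * xi l x)) = 0) : Orth 3 f := by
  have cx := cxi
  have o1 (k : Fin 3) : I (fun x => f x * xi k x) = 0 :=
    I_odd fun x hx => by rw [xi_neg, he x hx]; ring
  have o2 (k l : Fin 3) : I (fun x => f x * xi k x * xi l x) = 0 := by
    rw [← h2 k l]; exact I_congr fun x _ => by ring
  have o3 (k l m : Fin 3) : I (fun x => f x * xi k x * xi l x * xi m x) = 0 :=
    I_odd fun x hx => by rw [xi_neg, xi_neg, xi_neg, he x hx]; ring
  have z0 := orth_zero hf h0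
  have z1 (k) := orth_zero (hf.mul (cx k)) (o1 k)
  have z2 (k l) := orth_zero ((hf.mul (cx k)).mul (cx l)) (o2 k l)
  have z3 (k l m) := orth_zero (((hf.mul (cx k)).mul (cx l)).mul (cx m)) (o3 k l m)
  have y0 := orth_succ hf z0 z1
  have y1 (k) := orth_succ (hf.mul (cx k)) (z1 k) (z2 k)
  have y2 (k l) := orth_succ ((hf.mul (cx k)).mul (cx l)) (z2 k l) (z3 k l)
  have w0 := orth_succ hf y0 y1
  have w1 (k) := orth_succ (hf.mul (cx k)) (y1 k) (y2 k)
  exact orth_succ hf w0 w1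

lemma CS9 (N K : Mt) : (∑ a, ∑ b, N a b * K a b) ^ 2 ≤
    (∑ a, ∑ b, N a b ^ 2) * (∑ a, ∑ b, K a b ^ 2) := by
  have := Finset.sum_mul_sq_le_sq_mul_sq (Finset.univ : Finset (Fin 3 × Fin 3))
    (fun p => N p.1 p.2) (fun p => K p.1 p.2)
  simpa only [Fintype.sum_prod_type] using this

def n2 (N : Mt) : ℝ := ∑ a, ∑ b, N a b ^ 2

lemma bd_R (N : Mt) (ht : tr N = 0) (z R : V) (hz : z 0 ^ 2 + z 1 ^ 2 + z 2 ^ 2 = 1)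
    (hp : z 0 * R 0 + z 1 * R 1 + z 2 * R 2 = 0) :
    (2 * ∑ a, ∑ b, N a b * (R a * R b) + (∑ a, ∑ b, N a b * (z a * z b)) * (R 0 * R 0 + R 1 * R 1 + R 2 * R 2)) ^ 2
      ≤ 2 * n2 N * (R 0 * R 0 + R 1 * R 1 + R 2 * R 2) ^ 2 := by
  have h := CS9 N (fun a b => 2 * (R a * R b) + (R 0 * R 0 + R 1 * R 1 + R 2 * R 2) * (z a * z b - dl a b))
  have e1 : ∑ a, ∑ b, N a b * (2 * (R a * R b) + (R 0 * R 0 + R 1 * R 1 + R 2 * R 2) * (z a * z b - dl a b))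
      = 2 * ∑ a, ∑ b, N a b * (R a * R b) + (∑ a, ∑ b, N a b * (z a * z b)) * (R 0 * R 0 + R 1 * R 1 + R 2 * R 2) := by
    unfold tr at ht
    simp [Fin.sum_univ_three, dl]
    linear_combination (-(R 0 * R 0 + R 1 * R 1 + R 2 * R 2)) * ht
  have e2 : ∑ a, ∑ b, (2 * (R a * R b) + (R 0 * R 0 + R 1 * R 1 + R 2 * R 2) * (z a * z b - dl a b)) ^ 2
      = 2 * (R 0 * R 0 + R 1 * R 1 + R 2 * R 2) ^ 2 := by
    simp [Fin.sum_univ_three, dl]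
    linear_combination (R 0 * R 0 + R 1 * R 1 + R 2 * R 2) ^ 2 * (z 0 ^ 2 + z 1 ^ 2 + z 2 ^ 2 - 1) * hz
      + 4 * (R 0 * R 0 + R 1 * R 1 + R 2 * R 2) * (z 0 * R 0 + z 1 * R 1 + z 2 * R 2) * hp
  rw [e1, e2] at h
  unfold n2
  linarith

lemma bd_z (N : Mt) (ht : tr N = 0) (z : V) (hz : z 0 ^ 2 + z 1 ^ 2 + z 2 ^ 2 = 1) :
    (∑ a, ∑ b, N a b * (z a * z b)) ^ 2 ≤ 2 / 3 * n2 N := by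
  have h := CS9 N (fun a b => z a * z b - dl a b / 3)
  have e1 : ∑ a, ∑ b, N a b * (z a * z b - dl a b / 3) = ∑ a, ∑ b, N a b * (z a * z b) := by
    unfold tr at ht
    simp [Fin.sum_univ_three, dl]
    linear_combination (-1 / 3) * ht
  have e2 : ∑ a, ∑ b, (z a * z b - dl a b / 3) ^ 2 = 2 / 3 := by
    simp [Fin.sum_univ_three, dl]
    linear_combination (z 0 ^ 2 + z 1 ^ 2 + z 2 ^ 2 + 1 / 3) * hz
  rw [e1, e2] at h
  unfold n2
  linarith

/-- traceless part of the square -/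
def Nq (M : Mt) : Mt := fun a b => mm M M a b - n2 M / 3 * dl a b

lemma mm_sym {M : Mt} (hM : Sym M) : Sym (mm M M) := by
  intro a b
  unfold mm
  refine Finset.sum_congr rfl fun c _ => ?_
  rw [hM a c, hM c b, mul_comm]

lemma dl_comm (a b : Fin 3) : dl a b = dl b a := by unfold dl; simp [eq_comm]

lemma Nq_sym {M : Mt} (hM : Sym M) : Sym (Nq M) := by
  intro a b
  unfold Nq
  rw [mm_sym hM a b, dl_comm]

lemma tr_mm {M : Mt} (hM : Sym M) : tr (mm M M) = n2 M := by
  have h1 := hM 1 0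
  have h2 := hM 2 0
  have h3 := hM 2 1
  simp only [tr, mm, n2, Fin.sum_univ_three, h1, h2, h3]
  ring

lemma tr_Nq {M : Mt} (hM : Sym M) : tr (Nq M) = 0 := by
  have := tr_mm hM
  unfold tr at *
  simp [Nq, dl]
  linarith

lemma n2_Nq {M : Mt} (hM : Sym M) (ht : tr M = 0) : n2 (Nq M) = n2 M ^ 2 / 6 := by
  have h1 := hM 1 0
  have h2 := hM 2 0
  have h3 := hM 2 1
  have h4 : M 2 2 = - M 0 0 - M 1 1 := by unfold tr at ht; linarith
  simp only [n2, Nq, mm, Fin.sum_univ_three, h1, h2, h3, h4]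
  simp [dl]
  ring

lemma tr_NM {M : Mt} (hM : Sym M) (ht : tr M = 0) : tr (mm (Nq M) (mm M M)) = n2 M ^ 2 / 6 := by
  have h1 := hM 1 0
  have h2 := hM 2 0
  have h3 := hM 2 1
  have h4 : M 2 2 = - M 0 0 - M 1 1 := by unfold tr at ht; linarith
  simp only [n2, Nq, mm, tr, Fin.sum_univ_three, h1, h2, h3, h4]
  simp [dl]
  ring

lemma I_NYY {M : Mt} (hM : Sym M) (ht : tr M = 0) :
    I (fun x => Q (Nq M) x * (Q M x * Q M x)) = 4 / 315 * n2 M ^ 2 := by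
  have hN := tr_Nq hM
  have ht' := ht
  have hN' := hN
  unfold tr at ht' hN'
  have h := Green2 (cQ (Nq M)) (g := fun y => Q M y * Q M y) ((cQ M).mul (cQ M))
  have c1 := conQ (Nq M)
  have c2 := conQ M
  have c3 := conQ (mm M M)
  rw [I_lin2 8 (-20) (F := fun x => Q (Nq M) x * Lap (fun y => Q M y * Q M y) x)
    (f := fun x => Q (Nq M) x * Q (mm M M) x) (g := fun x => Q (Nq M) x * (Q M x * Q M x)) (by fun_prop)
    (by fun_prop) (fun x hx => by rw [Lap_QQ hM hM hx, ht']; ring),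
    I_lin1 (-6) (F := fun x => Q M x * Q M x * Lap (Q (Nq M)) x)
    (f := fun x => Q (Nq M) x * (Q M x * Q M x))
    (fun x hx => by rw [Lap_Q _ hx, hN']; ring), I_QQ (mm_sym hM) (Nq_sym hM), hN, tr_NM hM ht] at h
  linarith

/-! the second moment matrix -/
def Mw (u : V → ℝ) : Mt := fun a b => 15 / 2 * I (fun x => (Real.exp (u x) - 1) * (xi a x * xi b x))

lemma Mw_sym (u : V → ℝ) : Sym (Mw u) := by
  intro a b
  unfold Mw
  congr 1
  exact I_congr fun x _ => by ring

lemma Sol.cw {u : V → ℝ} (s : Sol u) : ContinuousOn (fun x => Real.exp (u x) - 1) Om := by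
  have := s.coe
  fun_prop

lemma Mw_tr {u : V → ℝ} (s : Sol u) : tr (Mw u) = 0 := by
  have cx := cxi
  have h := s.Iw
  rw [I_lin3 1 1 1 (f := fun x => (Real.exp (u x) - 1) * (xi 0 x * xi 0 x))
    (g := fun x => (Real.exp (u x) - 1) * (xi 1 x * xi 1 x))
    (k := fun x => (Real.exp (u x) - 1) * (xi 2 x * xi 2 x)) (s.cw.mul ((cx 0).mul (cx 0)))
     (s.cw.mul ((cx 1).mul (cx 1)))  (s.cw.mul ((cx 2).mul (cx 2)))
     (fun x hx => by linear_combination (-(Real.exp (u x) - 1)) * xi_sq hx)] at h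
  unfold tr Mw
  linarith

def hh (u : V → ℝ) (x : V) : ℝ := Real.exp (u x) - 1 - Q (Mw u) x
def gg (u : V → ℝ) (x : V) : ℝ := u x - I u - Q (Mw u) x

lemma Q_even (M : Mt) (x : V) : Q M (-x) = Q M x := by
  simp [Q, xi_neg]

lemma Q_hom (M : Mt) : Hom (Q M) := by
  intro c hc x hx
  simp only [Q, xi_hom _ c hc x hx]

lemma Sol.chh {u : V → ℝ} (s : Sol u) : ContDiffOn ℝ 2 (hh u) Om :=
  (s.ce.sub contDiffOn_const).sub (cQ _)
lemma Sol.cgg {u : V → ℝ} (s : Sol u) : ContDiffOn ℝ 2 (gg u) Om :=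
  (s.c2.sub contDiffOn_const).sub (cQ _)

lemma Sol.hh_hom {u : V → ℝ} (s : Sol u) : Hom (hh u) := by
  intro c hc x hx
  simp only [hh, s.hom c hc x hx, Q_hom _ c hc x hx]
lemma Sol.gg_hom {u : V → ℝ} (s : Sol u) : Hom (gg u) := by
  intro c hc x hx
  simp only [gg, s.hom c hc x hx, Q_hom _ c hc x hx]

lemma Sol.Iuxx {u : V → ℝ} (s : Sol u) (k l : Fin 3) : I (fun x => u x * (xi k x * xi l x)) =
    I (fun x => (Real.exp (u x) - 1) * (xi k x * xi l x)) + dl k l / 3 * I u := by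
  have cx := cxi
  have h := Green2 s.c2 (g := fun x => xi k x * xi l x) ((cd_xi k).mul (cd_xi l))
  have c := (cx k).mul (cx l)
  rw [I_lin2 (-6) (2 * dl k l) (F := fun x => u x * Lap (fun x => xi k x * xi l x) x)
    (f := fun x => u x * (xi k x * xi l x)) (g := u) (s.co.mul c) s.co
    (fun x hx => by rw [Lap_xixi _ _ hx]; ring),
    I_lin1 (-6) (F := fun x => xi k x * xi l x * Lap u x)
      (f := fun x => (Real.exp (u x) - 1) * (xi k x * xi l x)) (fun x hx => by rw [s.eq x hx]; ring)] at h
  linarith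

lemma Sol.hxx {u : V → ℝ} (s : Sol u) (k l : Fin 3) : I (fun x => hh u x * (xi k x * xi l x)) = 0 := by
  have cx := cxi
  have c := (cx k).mul (cx l)
  rw [I_lin2 1 (-1) (f := fun x => (Real.exp (u x) - 1) * (xi k x * xi l x))
    (g := fun x => Q (Mw u) x * (xi k x * xi l x)) (s.cw.mul c) ((conQ _).mul c)
    (fun x _ => by unfold hh; ring), I_Qxixi (Mw_sym u) (Mw_tr s)]
  unfold Mw
  ring

lemma Sol.gxx {u : V → ℝ} (s : Sol u) (k l : Fin 3) : I (fun x => gg u x * (xi k x * xi l x)) = 0 := by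
  have cx := cxi
  have c := (cx k).mul (cx l)
  rw [I_lin3 1 (- I u) (-1) (f := fun x => u x * (xi k x * xi l x)) (g := fun x => xi k x * xi l x)
    (k := fun x => Q (Mw u) x * (xi k x * xi l x)) (s.co.mul c) c ((conQ _).mul c)
    (fun x _ => by unfold gg; ring), I_Qxixi (Mw_sym u) (Mw_tr s), s.Iuxx, I_xixi]
  unfold Mw
  ring

lemma Sol.hO {u : V → ℝ} (s : Sol u) : Orth 3 (hh u) := by
  refine orth3_even s.chh.continuousOn (fun x hx => ?_) ?_ s.hxx
  · unfold hh; rw [s.even x hx, Q_even]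
  · rw [I_lin2 1 (-1) (f := fun x => Real.exp (u x) - 1) s.cw (conQ (Mw u))
      (fun x _ => by unfold hh; ring), s.Iw, I_Q]
    have := Mw_tr s
    unfold tr at this
    rw [this]; simp

lemma Sol.gO {u : V → ℝ} (s : Sol u) : Orth 3 (gg u) := by
  refine orth3_even s.cgg.continuousOn (fun x hx => ?_) ?_ s.gxx
  · unfold gg; rw [s.even x hx, Q_even]
  · rw [I_lin3 1 (- I u) (-1) (f := u) (g := fun _ => 1) s.co continuousOn_const (conQ (Mw u))
      (fun x _ => by unfold gg; ring), I_one, I_Q]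
    have := Mw_tr s
    unfold tr at this
    rw [this]; simp

lemma Sol.hQ {u : V → ℝ} (s : Sol u) (K : Mt) : I (fun x => hh u x * Q K x) = 0 := by
  rw [I_mulQ s.chh.continuousOn]
  simp [s.hxx]

lemma Sol.gQ {u : V → ℝ} (s : Sol u) (K : Mt) : I (fun x => gg u x * Q K x) = 0 := by
  rw [I_mulQ s.cgg.continuousOn]
  simp [s.gxx]

lemma Sol.LQ {u : V → ℝ} (s : Sol u) {x : V} (hx : x ∈ Om) : Lap (Q (Mw u)) x = -6 * Q (Mw u) x := by
  have := Mw_tr s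
  unfold tr at this
  rw [Lap_Q _ hx, this]; ring

lemma Sol.Lg {u : V → ℝ} (s : Sol u) {x : V} (hx : x ∈ Om) : Lap (gg u) x = -6 * hh u x := by
  rw [Lap_congr (g := fun y => (fun y => u y + (fun _ => - I u) y) y + (fun y => (-1) * Q (Mw u) y) y)
    (fun y _ => by unfold gg; ring) hx,
    Lap_add (f := fun y => u y + (fun _ => - I u) y) (g := fun y => (-1) * Q (Mw u) y)
      ((cdat s.c2 hx).add contDiffAt_const) (contDiffAt_const.mul (cdat (cQ _) hx)),
    Lap_add (cdat s.c2 hx) contDiffAt_const, Lap_const, Lap_smul _ (cdat (cQ _) hx), s.LQ hx, s.eq x hx]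
  unfold hh
  ring

lemma Sol.Lh {u : V → ℝ} (s : Sol u) {x : V} (hx : x ∈ Om) :
    Lap (hh u) x = Lap (fun y => Real.exp (u y)) x + 6 * Q (Mw u) x := by
  rw [Lap_congr (g := fun y => (fun y => Real.exp (u y) + (fun _ => - 1) y) y + (fun y => (-1) * Q (Mw u) y) y)
    (fun y _ => by unfold hh; ring) hx,
    Lap_add (f := fun y => Real.exp (u y) + (fun _ => - 1) y) (g := fun y => (-1) * Q (Mw u) y)
      ((cdat s.ce hx).add contDiffAt_const) (contDiffAt_const.mul (cdat (cQ _) hx)),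
    Lap_add (cdat s.ce hx) contDiffAt_const, Lap_const, Lap_smul _ (cdat (cQ _) hx), s.LQ hx]
  ring

lemma Sol.yval {u : V → ℝ} (s : Sol u) : I (fun x => Q (Mw u) x * Q (Mw u) x) = 2 / 15 * n2 (Mw u) := by
  rw [I_QQ (Mw_sym u) (Mw_sym u), Mw_tr s, tr_mm (Mw_sym u)]
  ring

/-- `11 b ≤ 3 y` -/
lemma Sol.bound_b {u : V → ℝ} (s : Sol u) :
    11 * I (fun x => hh u x * hh u x) ≤ 3 * I (fun x => Q (Mw u) x * Q (Mw u) x) := by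
  have cw := s.cw
  have cq := conQ (Mw u)
  have ce := s.coe
  have ch : ContinuousOn (hh u) Om := s.chh.continuousOn
  have cL : ContinuousOn (Lap (fun y => Real.exp (u y))) Om := cLap s.ce
  have hp := poinc s.chh s.hh_hom 3 s.hO
  -- energy of `exp u`
  have hE : I (fun x => Real.exp (u x) * Lap (fun y => Real.exp (u y)) x)
      = - 3 * I (fun x => Real.exp (u x) ^ 2 * (Real.exp (u x) - 1)) := by
    rw [Green (c2c1 s.ce) s.ce]
    have h2 := Green (f := fun x => Real.exp (u x) ^ 2) (c2c1 (s.ce.pow 2)) s.c2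
    rw [I_lin1 (-6) (f := fun x => Real.exp (u x) ^ 2 * (Real.exp (u x) - 1)) (fun x hx => by
        rw [s.eq x hx]; ring),
      I_lin1 2 (F := Grad (fun x => Real.exp (u x) ^ 2) u)
        (f := Grad (fun x => Real.exp (u x)) (fun x => Real.exp (u x))) (fun x hx => by
        have hd := diffAt two_ne_zero s.c2 hx
        rw [Grad_comm, Grad_comp (φ := fun t => Real.exp t ^ 2) hd ((Real.hasDerivAt_exp _).pow 2),
          Grad_comp (φ := fun t => Real.exp t) (h := fun x => Real.exp (u x)) hd (Real.hasDerivAt_exp _),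
          Grad_comm (fun x => Real.exp (u x)) u, Grad_comp (φ := fun t => Real.exp t) hd (Real.hasDerivAt_exp _)]
        simp; ring)] at h2
    linarith
  have h1 : I (fun x => Q (Mw u) x * Lap (fun y => Real.exp (u y)) x)
      = -6 * I (fun x => Q (Mw u) x * Q (Mw u) x) := by
    rw [Green2 (cQ _) s.ce]
    have a := s.hQ (Mw u)
    have b : I (Q (Mw u)) = 0 := by
      rw [I_Q]
      have := Mw_tr s
      unfold tr at this
      rw [this]; simp
    rw [I_lin3 (-6) (-6) (-6) (f := fun x => hh u x * Q (Mw u) x) (g := Q (Mw u))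
      (k := fun x => Q (Mw u) x * Q (Mw u) x)
      (ch.mul cq) cq (cq.mul cq) (fun x hx => by rw [s.LQ hx]; unfold hh; ring), a, b]
    ring
  have h0 : I (Lap (fun y => Real.exp (u y))) = 0 := I_Lap s.ce
  have e1 : I (fun x => hh u x * Lap (hh u) x) =
      -3 * I (fun x => Real.exp (u x) ^ 2 * (Real.exp (u x) - 1))
      + 6 * I (fun x => Q (Mw u) x * Q (Mw u) x) := by
    rw [I_lin4 1 (-1) (-1) 6 (f := fun x => Real.exp (u x) * Lap (fun y => Real.exp (u y)) x)
      (g := Lap (fun y => Real.exp (u y)))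
      (k := fun x => Q (Mw u) x * Lap (fun y => Real.exp (u y)) x)
      (l := fun x => hh u x * Q (Mw u) x) (ce.mul cL) cL (cq.mul cL) (ch.mul cq)
      (fun x hx => by rw [s.Lh hx]; unfold hh; ring), hE, h0, h1, s.hQ]
    ring
  have hw2 : I (fun x => (Real.exp (u x) - 1) * (Real.exp (u x) - 1)) =
      I (fun x => hh u x * hh u x) + I (fun x => Q (Mw u) x * Q (Mw u) x) := by
    rw [I_lin3 1 1 2 (f := fun x => hh u x * hh u x) (g := fun x => Q (Mw u) x * Q (Mw u) x)
      (k := fun x => hh u x * Q (Mw u) x) (ch.mul ch) (cq.mul cq) (ch.mul cq)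
      (fun x hx => by unfold hh; ring), s.hQ]
    ring
  have hm : I (fun x => Real.exp (u x) ^ 2 * (Real.exp (u x) - 1)) ≤
      I (fun x => 3 * ((Real.exp (u x) - 1) * (Real.exp (u x) - 1)) + (Real.exp (u x) - 1)) := by
    refine I_mono (by fun_prop) (by fun_prop) fun x hx => ?_
    nlinarith [mul_nonneg (sq_nonneg (Real.exp (u x) - 1)) (sub_nonneg.mpr (s.bd x hx))]
  rw [I_lin2 3 1 (f := fun x => (Real.exp (u x) - 1) * (Real.exp (u x) - 1)) (cw.mul cw) cw
    (F := fun x => 3 * ((Real.exp (u x) - 1) * (Real.exp (u x) - 1)) + (Real.exp (u x) - 1))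
    (fun x _ => by ring), s.Iw, hw2] at hm
  rw [e1] at hp
  norm_num at hp
  linarith

/-- Dirichlet energy of `g` -/
lemma Sol.bound_g {u : V → ℝ} (s : Sol u) :
    I (Grad (gg u) (gg u)) ≤ 9 / 5 * I (fun x => hh u x * hh u x) := by
  have ch : ContinuousOn (hh u) Om := s.chh.continuousOn
  have cg : ContinuousOn (gg u) Om := s.cgg.continuousOn
  have hp := poinc s.cgg s.gg_hom 3 s.gO
  have hG := Green (c2c1 s.cgg) s.cgg
  have e : I (fun x => gg u x * Lap (gg u) x) = -6 * I (fun x => gg u x * hh u x) :=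
    I_lin1 _ fun x hx => by rw [s.Lg hx]; ring
  have h := I_nonneg (f := fun x => (hh u x - 10 / 3 * gg u x) ^ 2) fun x _ => sq_nonneg _
  rw [I_lin3 1 (-20 / 3) (100 / 9) (f := fun x => hh u x * hh u x) (g := fun x => gg u x * hh u x)
    (k := fun x => gg u x * gg u x) (ch.mul ch) (cg.mul ch) (cg.mul cg) (fun x _ => by ring)] at h
  norm_num at hp
  linarith

end MF

namespace MF

lemma Sol.Gu {u : V → ℝ} (s : Sol u) (f : V → ℝ) {x : V} (hx : x ∈ Om) :
    Grad f u x = Grad f (gg u) x + Grad f (Q (Mw u)) x := by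
  have e : Grad f u x = Grad f (fun y => (fun y => gg u y + Q (Mw u) y) y + (fun _ => I u) y) x :=
    Grad_congr (fun y _ => by unfold gg; ring) hx
  have dg := diffAt two_ne_zero s.cgg hx
  have dq := diffAt two_ne_zero (cQ (Mw u)) hx
  rw [e, Grad_add (f := fun y => gg u y + Q (Mw u) y) (dg.add dq) (differentiableAt_const _), Grad_const,
    Grad_add dg dq, add_zero]

lemma Sol.ident {u : V → ℝ} (s : Sol u) :
    3 * I (fun x => Q (Nq (Mw u)) x * (Q (Mw u) x * Q (Mw u) x))
     - I (fun x => hh u x * (Q (Nq (Mw u)) x * Q (Mw u) x))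
     + I (fun x => hh u x * Grad (Q (Nq (Mw u))) (gg u) x) = 0 := by
  have hMs := Mw_sym u
  have hNs := Nq_sym hMs
  have hMt := Mw_tr s
  have hNt := tr_Nq hMs
  have ch : ContinuousOn (hh u) Om := s.chh.continuousOn
  have cg : ContinuousOn (gg u) Om := s.cgg.continuousOn
  have cu := s.co
  have cw := s.cw
  have hLY (x) (hx : x ∈ Om) := s.LQ hx
  have hgQ := s.gQ
  have hhQ := s.hQ
  have hu (f : V → ℝ) (x) (hx : x ∈ Om) := s.Gu f hx
  have hwh (x : V) : Real.exp (u x) - 1 = Q (Mw u) x + hh u x := by unfold hh; ring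
  generalize hM : Mw u = M at *
  generalize hN : Nq M = N at *
  have hMt' := hMt
  have hNt' := hNt
  unfold tr at hMt' hNt'
  have c1 := conQ M
  have c2 := conQ N
  have c3 := conQ (mm N M)
  have d1 := cQ M (n := 2)
  have d2 := cQ N (n := 2)
  have cG1 : ContinuousOn (Grad (Q N) (gg u)) Om := cGrad (cQ N) (c2c1 s.cgg)
  have cG2 : ContinuousOn (Grad (Q N) (Q M)) Om := cGrad (cQ N) (cQ M)
  have hLN (x) (hx : x ∈ Om) : Lap (Q N) x = -6 * Q N x := by rw [Lap_Q N hx, hNt']; ring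
  have iN : I (Q N) = 0 := by rw [I_Q, hNt']; simp
  -- I (w Grad φ u) = 0
  have k1 := Green2 s.c2 d2
  rw [I_lin1 (-6) (F := fun x => u x * Lap (Q N) x) (f := fun x => u x * Q N x)
      (fun x hx => by rw [hLN x hx]; ring),
    I_lin1 (-6) (F := fun x => Q N x * Lap u x) (f := fun x => (Real.exp (u x) - 1) * Q N x)
      (fun x hx => by rw [s.eq x hx]; ring)] at k1
  have k2 := Green (f := fun x => Real.exp (u x) - u x) (c2c1 (s.ce.sub s.c2)) d2
  rw [I_lin4 1 1 1 1 (F := Grad (fun x => Real.exp (u x) - u x) (Q N))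
    (f := fun x => Q M x * Grad (Q N) (gg u) x)
    (g := fun x => Q M x * Grad (Q N) (Q M) x) (k := fun x => hh u x * Grad (Q N) (gg u) x)
    (l := fun x => hh u x * Grad (Q N) (Q M) x) (c1.mul cG1) (c1.mul cG2) (ch.mul cG1) (ch.mul cG2)
    (fun x hx => by
      rw [Grad_comm, Grad_comp (φ := fun t => Real.exp t - t) (diffAt two_ne_zero s.c2 hx)
        ((Real.hasDerivAt_exp _).sub (hasDerivAt_id _)), hu _ x hx, hwh]; ring),
    I_lin3 (-6) 6 (-6) (f := fun x => (Real.exp (u x) - 1) * Q N x) (g := fun x => u x * Q N x)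
      (k := Q N) (by fun_prop) (by fun_prop) c2 (fun x hx => by rw [hLN x hx]; ring), iN] at k2
  -- I (Y Grad φ Y)
  have k3 := Green (f := fun x => Q M x * Q M x) (c2c1 (d1.mul d1)) d2
  rw [I_lin1 (-6) (f := fun x => Q N x * (Q M x * Q M x)) (fun x hx => by rw [hLN x hx]; ring),
    I_lin1 2 (F := Grad (fun x => Q M x * Q M x) (Q N)) (f := fun x => Q M x * Grad (Q N) (Q M) x)
    (fun x hx => by
      have := diffAt two_ne_zero d1 hx
      rw [Grad_comm, Grad_mul this this]; ring)] at k3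
  -- I (Y Grad φ g)
  have k4 := Green (f := fun x => gg u x * Q M x) (c2c1 (s.cgg.mul d1)) d2
  rw [I_lin1 (-6) (f := fun x => gg u x * (Q N x * Q M x)) (fun x hx => by rw [hLN x hx]; ring),
    I_lin3 1 4 (-4) (F := Grad (fun x => gg u x * Q M x) (Q N)) (f := fun x => Q M x * Grad (Q N) (gg u) x)
    (g := fun x => gg u x * Q (mm N M) x) (k := fun x => gg u x * (Q N x * Q M x)) (c1.mul cG1) (cg.mul c3)
    (cg.mul (c2.mul c1))
    (fun x hx => by
      rw [Grad_comm, Grad_mul (diffAt two_ne_zero s.cgg hx) (diffAt two_ne_zero d1 hx),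
        Grad_QQ hMs hNs hx]; ring), hgQ] at k4
  -- I (h Grad φ Y)
  have k5 : I (fun x => hh u x * Grad (Q N) (Q M) x) = -4 * I (fun x => hh u x * (Q N x * Q M x)) := by
    rw [I_lin2 4 (-4) (f := fun x => hh u x * Q (mm N M) x) (g := fun x => hh u x * (Q N x * Q M x))
      (ch.mul c3) (ch.mul (c2.mul c1)) (fun x hx => by rw [Grad_QQ hMs hNs hx]; ring), hhQ]
    ring
  have k6 := Green2 s.cgg (g := fun x => Q N x * Q M x) (d2.mul d1)
  rw [I_lin2 8 (-20) (F := fun x => gg u x * Lap (fun x => Q N x * Q M x) x)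
    (f := fun x => gg u x * Q (mm N M) x) (g := fun x => gg u x * (Q N x * Q M x))
    (cg.mul c3) (cg.mul (c2.mul c1)) (fun x hx => by rw [Lap_QQ hMs hNs hx, hMt', hNt']; ring), hgQ,
    I_lin1 (-6) (F := fun x => Q N x * Q M x * Lap (gg u) x) (f := fun x => hh u x * (Q N x * Q M x))
    (fun x hx => by rw [s.Lg hx]; ring)] at k6
  linarith

lemma n2_nonneg (M : Mt) : 0 ≤ n2 M :=
  Finset.sum_nonneg fun _ _ => Finset.sum_nonneg fun _ _ => sq_nonneg _

lemma Sol.bound_hess {u : V → ℝ} (s : Sol u) :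
    - (29 / 300) * n2 (Mw u) * I (Grad (gg u) (gg u))
      ≤ I (fun x => hh u x * Grad (Q (Nq (Mw u))) (gg u) x) := by
  have hMs := Mw_sym u
  have hMt := Mw_tr s
  have hNt := tr_Nq hMs
  have hn := n2_Nq hMs hMt
  have hs := n2_nonneg (Mw u)
  generalize hM : Mw u = M at *
  generalize hN : Nq M = N at *
  have hNt' := hNt
  unfold tr at hNt'
  have cG : ContinuousOn (Grad (gg u) (gg u)) Om := cGrad (c2c1 s.cgg) (c2c1 s.cgg)
  have c2 := conQ N
  have cH : ContinuousOn (Hs (Q N) (gg u)) Om := cHs (cQ N) s.cgg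
  have hb := Bochner (cQ N) s.cgg
  rw [I_lin1 (-6) (F := fun x => Lap (gg u) x * Grad (Q N) (gg u) x)
    (f := fun x => hh u x * Grad (Q N) (gg u) x) (fun x hx => by rw [s.Lg hx]; ring),
    I_lin1 (-6) (F := fun x => Lap (Q N) x * Grad (gg u) (gg u) x)
    (f := fun x => Q N x * Grad (gg u) (gg u) x) (fun x hx => by rw [Lap_Q N hx, hNt']; ring)] at hb
  have hm : I (fun x => - (29 / 50) * n2 M * Grad (gg u) (gg u) x)
      ≤ I (fun x => Hs (Q N) (gg u) x + 3 * (Q N x * Grad (gg u) (gg u) x)) := by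
    refine I_mono (by fun_prop) (by fun_prop) fun x hx => ?_
    rw [Hs_Q N _ hx]
    have hR := bd_R N hNt (fun k => xi k x) (fun k => Grad (xi k) (gg u) x) (xi_sq hx)
      (Grad_coord_perp _ hx)
    beta_reduce at hR
    rw [← Grad_coord (gg u) (gg u) hx, hn] at hR
    have hp : 0 ≤ Grad (gg u) (gg u) x := by
      unfold Grad; nlinarith [mul_self_nonneg (X 0 (gg u) x), mul_self_nonneg (X 1 (gg u) x),
        mul_self_nonneg (X 2 (gg u) x)]
    have hq : (∑ a, ∑ b, N a b * (xi a x * xi b x)) = Q N x := rfl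
    rw [hq] at hR
    generalize Grad (gg u) (gg u) x = G at *
    generalize (∑ a, ∑ b, N a b * (Grad (xi a) (gg u) x * Grad (xi b) (gg u) x)) = S at *
    have h3 : (2 * S + Q N x * G) ^ 2 ≤ (29 / 50 * n2 M * G) ^ 2 := by
      nlinarith [sq_nonneg (n2 M * G)]
    have h4 := abs_le_of_sq_le_sq' h3 (by positivity)
    linarith [h4.1]
  rw [I_lin1 (- (29 / 50) * n2 M) (F := fun x => - (29 / 50) * n2 M * Grad (gg u) (gg u) x)
      (f := Grad (gg u) (gg u)) (fun x _ => rfl),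
    I_lin2 1 3 (F := fun x => Hs (Q N) (gg u) x + 3 * (Q N x * Grad (gg u) (gg u) x))
    (f := Hs (Q N) (gg u)) (g := fun x => Q N x * Grad (gg u) (gg u) x) cH (c2.mul cG)
    (fun x _ => by ring)] at hm
  linarith

lemma Sol.bound_cubic {u : V → ℝ} (s : Sol u) :
    I (fun x => hh u x * (Q (Nq (Mw u)) x * Q (Mw u) x)) ≤
     n2 (Mw u) / 3 * (I (fun x => hh u x * hh u x) + 1 / 4 * I (fun x => Q (Mw u) x * Q (Mw u) x)) := by
  have hMs := Mw_sym u
  have hMt := Mw_tr s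
  have hNt := tr_Nq hMs
  have hn := n2_Nq hMs hMt
  have hs := n2_nonneg (Mw u)
  have ch : ContinuousOn (hh u) Om := s.chh.continuousOn
  generalize hM : Mw u = M at *
  generalize hN : Nq M = N at *
  have c1 := conQ M
  have c2 := conQ N
  have hm : I (fun x => hh u x * (Q N x * Q M x)) ≤
      I (fun x => n2 M / 3 * (hh u x * hh u x + 1 / 4 * (Q M x * Q M x))) := by
    refine I_mono (by fun_prop) (by fun_prop) fun x hx => ?_
    have hz := bd_z N hNt (fun k => xi k x) (xi_sq hx)
    have hq : (∑ a, ∑ b, N a b * (xi a x * xi b x)) = Q N x := rfl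
    beta_reduce at hz
    rw [hq, hn] at hz
    have h4 := abs_le_of_sq_le_sq' (show Q N x ^ 2 ≤ (n2 M / 3) ^ 2 by linarith) (by positivity)
    nlinarith [mul_nonneg (sub_nonneg.mpr h4.2) (sq_nonneg (hh u x + Q M x / 2)),
      mul_nonneg (by linarith [h4.1] : 0 ≤ n2 M / 3 + Q N x) (sq_nonneg (hh u x - Q M x / 2))]
  rw [I_lin2 (n2 M / 3) (n2 M / 12) (F := fun x => n2 M / 3 * (hh u x * hh u x + 1 / 4 * (Q M x * Q M x)))
    (f := fun x => hh u x * hh u x) (g := fun x => Q M x * Q M x) (ch.mul ch) (c1.mul c1)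
    (fun x _ => by ring)] at hm
  linarith

lemma Sol.n2_zero {u : V → ℝ} (s : Sol u) : n2 (Mw u) = 0 := by
  have h1 := s.ident
  rw [I_NYY (Mw_sym u) (Mw_tr s)] at h1
  have h2 := s.bound_hess
  have h3 := s.bound_cubic
  have h4 := s.bound_b
  have h5 := s.bound_g
  rw [s.yval] at h3 h4
  have hs := n2_nonneg (Mw u)
  generalize n2 (Mw u) = σ at *
  generalize I (fun x => hh u x * hh u x) = b at *
  have h6 := mul_le_mul_of_nonneg_left h4 hs
  have h7 := mul_le_mul_of_nonneg_left h5 hs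
  have : σ ^ 2 ≤ 0 := by nlinarith
  nlinarith

lemma Sol.zero {u : V → ℝ} (s : Sol u) : ∀ x ∈ Om, u x = 0 := by
  have hz := s.n2_zero
  have hb := s.bound_b
  rw [s.yval, hz] at hb
  have hM (a b : Fin 3) : Mw u a b = 0 := by
    unfold n2 at hz
    have h1 := (Finset.sum_eq_zero_iff_of_nonneg (fun i _ => Finset.sum_nonneg fun j _ =>
      sq_nonneg (Mw u i j))).mp hz a (Finset.mem_univ a)
    have h2 := (Finset.sum_eq_zero_iff_of_nonneg (fun j _ =>
      sq_nonneg (Mw u a j))).mp h1 b (Finset.mem_univ b)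
    exact pow_eq_zero_iff two_ne_zero |>.mp h2
  have ch : ContinuousOn (hh u) Om := s.chh.continuousOn
  have h0 := I_pos_zero (F := fun x => hh u x * hh u x) (ch.mul ch) (fun x _ => mul_self_nonneg _)
    (fun c hc x hx => by beta_reduce; rw [s.hh_hom c hc x hx]) (by linarith)
  intro x hx
  have h1 : hh u x = 0 := mul_self_eq_zero.mp (h0 x hx)
  have h2 : Q (Mw u) x = 0 := by simp [Q, hM]
  unfold hh at h1
  rw [h2] at h1
  have : Real.exp (u x) = 1 := by linarith
  exact (Real.exp_eq_one_iff _).mp this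

end MF

/-- A solution of `Δu = 6(1 - e^u)` on `S²` with `e^u ≤ 2` vanishes. -/
theorem bounded_solution_lambda_six_is_zero (u : (Fin 3 → ℝ) → ℝ)
    (hu : IsMFSolution 6 u)
    (hbound : ∀ x ∈ sphere3, Real.exp (u x) ≤ 2) :
    ∀ x ∈ sphere3, u x = 0 := by
  obtain ⟨h1, h2⟩ := MF.utl_facts hu
  have s : MF.Sol (MF.utl u) :=
    ⟨h1, MF.utl_hom u, h2, fun x hx => hbound _ (MF.xi_mem_sphere hx)⟩
  intro x hx
  have h := s.zero x (MF.sphere_Om hx)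
  unfold MF.utl at h
  rwa [MF.xi_of_sphere hx] at h
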